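/- arXiv:1801.01050 — 3 statements merged into one kernel-verified Lean document; each statement's English description precedes it below -/
import Mathlib

section
/- Let Y, X, U be random variables with finite alphabets 𝒴, 𝒳, 𝒰 such that the Markov chain Y ⊸ X ⊸ U holds. Then for any ε > 0 there exist n ∈ ℕ and a function f : 𝒳^n → M with M a finite set satisfying (1/n)·log|M| ≤ I(X;U) + ε and (1/n)·I(Y^n; f(X^n)) ≥ I(Y;U) − ε, where (Y^n,X^n) are n i.i.d. copies of (Y,X). -/
open MeasureTheory Real
open scoped ENNReal

noncomputable section

namespace IB

/-- Real-valued indicator function of a set. -/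
def ind {Ω : Type*} (s : Set Ω) : Ω → ℝ := Set.indicator s (fun _ => (1 : ℝ))

/-- Shannon entropy of a random variable with finite alphabet. -/
noncomputable def ent {Ω α : Type*} [MeasurableSpace Ω] [Fintype α]
    (μ : Measure Ω) (A : Ω → α) : ℝ :=
  ∑ a : α, Real.negMulLog ((μ (A ⁻¹' {a})).toReal)

/-- Discrete mutual information `I(A;B) = H(A) + H(B) - H(A,B)` for finite alphabets. -/
noncomputable def miFin {Ω α β : Type*} [MeasurableSpace Ω] [Fintype α] [Fintype β]
    (μ : Measure Ω) (A : Ω → α) (B : Ω → β) : ℝ :=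
  ent μ A + ent μ B - ent μ (fun ω => (A ω, B ω))

/-- Mutual information of random variables with arbitrary alphabets: the supremum of the
discrete mutual information over all measurable finite-range quantizations. -/
noncomputable def miGen {Ω α β : Type*} [MeasurableSpace Ω] [MeasurableSpace α]
    [MeasurableSpace β] (μ : Measure Ω) (A : Ω → α) (B : Ω → β) : ℝ≥0∞ :=
  ⨆ (k : ℕ) (l : ℕ) (f : α → Fin (k + 1)) (g : β → Fin (l + 1))
    (_ : Measurable f) (_ : Measurable g),
      ENNReal.ofReal (miFin μ (f ∘ A) (g ∘ B))

/-- The Markov chain `A ⊸ B ⊸ C`: conditional independence of `A` and `C` given `σ(B)`,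
expressed via conditional expectations of indicator functions. -/
def Markov {Ω α β γ : Type*} [MeasurableSpace Ω] [MeasurableSpace α] [MeasurableSpace β]
    [MeasurableSpace γ] (μ : Measure Ω) (A : Ω → α) (B : Ω → β) (C : Ω → γ) : Prop :=
  ∀ E F, MeasurableSet E → MeasurableSet F →
    μ[ind (A ⁻¹' E ∩ C ⁻¹' F) | MeasurableSpace.comap B inferInstance]
      =ᵐ[μ]
    fun ω => (μ[ind (A ⁻¹' E) | MeasurableSpace.comap B inferInstance]) ω *
             (μ[ind (C ⁻¹' F) | MeasurableSpace.comap B inferInstance]) ω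

/-- Mutual information of a joint mass function on a product of finite types. -/
noncomputable def info {α β : Type*} [Fintype α] [Fintype β] (r : α → β → ℝ) : ℝ :=
  ∑ a, negMulLog (∑ b, r a b) + ∑ b, negMulLog (∑ a, r a b) - ∑ a, ∑ b, negMulLog (r a b)

lemma info_eq_sum_log {α β : Type*} [Fintype α] [Fintype β] (r : α → β → ℝ) :
    info r = ∑ a, ∑ b, r a b * (log (r a b) - log (∑ b', r a b') - log (∑ a', r a' b)) := by
  have h1 : ∑ a, negMulLog (∑ b, r a b) = -∑ a, ∑ b, r a b * log (∑ b', r a b') := by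
    rw [← Finset.sum_neg_distrib]
    exact Finset.sum_congr rfl fun a _ => by rw [negMulLog, ← Finset.sum_mul]; ring
  have h2 : ∑ b, negMulLog (∑ a, r a b) = -∑ a, ∑ b, r a b * log (∑ a', r a' b) := by
    rw [Finset.sum_comm, ← Finset.sum_neg_distrib]
    exact Finset.sum_congr rfl fun a _ => by rw [negMulLog, ← Finset.sum_mul]; ring
  have h3 : ∑ a, ∑ b, negMulLog (r a b) = -∑ a, ∑ b, r a b * log (r a b) := by
    simp only [negMulLog, neg_mul, Finset.sum_neg_distrib]
  rw [info, h1, h2, h3]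
  simp only [mul_sub, Finset.sum_sub_distrib]
  ring

/-- Variational lower bound on mutual information. -/
lemma sum_mul_log_le_info {α β : Type*} [Fintype α] [Fintype β] (r L : α → β → ℝ)
    (hr : ∀ a b, 0 ≤ r a b) (hsum : ∑ a, ∑ b, r a b = 1) (hL : ∀ a b, 0 < L a b)
    (hL1 : ∀ b, ∑ a, (∑ b', r a b') * L a b ≤ 1) :
    ∑ a, ∑ b, r a b * log (L a b) ≤ info r := by
  have hA : ∀ a b, r a b ≤ ∑ b', r a b' := fun a b =>
    Finset.single_le_sum (f := fun b' => r a b') (fun _ _ => hr _ _) (Finset.mem_univ b)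
  have hB : ∀ a b, r a b ≤ ∑ a', r a' b := fun a b =>
    Finset.single_le_sum (f := fun a' => r a' b) (fun _ _ => hr _ _) (Finset.mem_univ a)
  have key : ∀ a b, r a b * log (L a b) ≤
      r a b * (log (r a b) - log (∑ b', r a b') - log (∑ a', r a' b)) - r a b +
        (∑ a', r a' b) * ((∑ b', r a b') * L a b) := by
    intro a b
    rcases (hr a b).eq_or_lt with h0 | h0
    · rw [← h0]
      have := mul_nonneg ((hr a b).trans (hB a b)) (mul_nonneg ((hr a b).trans (hA a b)) (hL a b).le)
      simpa using this
    · have ha := h0.trans_le (hA a b)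
      have hb := h0.trans_le (hB a b)
      have hl := hL a b
      have := log_le_sub_one_of_pos (div_pos (mul_pos hb (mul_pos ha hl)) h0)
      rw [log_div (by positivity) h0.ne', log_mul hb.ne' (by positivity),
        log_mul ha.ne' hl.ne'] at this
      have h2 := mul_le_mul_of_nonneg_left this h0.le
      rw [mul_sub (r a b) (_ / _), mul_div_cancel₀ _ h0.ne'] at h2
      linarith
  have hs : ∑ a, ∑ b, (∑ a', r a' b) * ((∑ b', r a b') * L a b) ≤ 1 := by
    rw [Finset.sum_comm]
    calc _ = ∑ b, (∑ a', r a' b) * ∑ a, (∑ b', r a b') * L a b := by simp only [Finset.mul_sum]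
      _ ≤ ∑ b, (∑ a', r a' b) * 1 := Finset.sum_le_sum fun b _ =>
          mul_le_mul_of_nonneg_left (hL1 b) (Finset.sum_nonneg fun _ _ => hr _ _)
      _ = 1 := by simp only [mul_one]; rw [Finset.sum_comm, hsum]
  have := Finset.sum_le_sum fun a (_ : a ∈ Finset.univ) =>
    Finset.sum_le_sum fun b (_ : b ∈ Finset.univ) => key a b
  simp only [Finset.sum_add_distrib, Finset.sum_sub_distrib] at this
  rw [info_eq_sum_log]
  linarith

lemma info_nonneg {α β : Type*} [Fintype α] [Fintype β] (r : α → β → ℝ)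
    (hr : ∀ a b, 0 ≤ r a b) (hsum : ∑ a, ∑ b, r a b = 1) : 0 ≤ info r := by
  simpa using sum_mul_log_le_info r (fun _ _ => 1) hr hsum (fun _ _ => one_pos)
    (fun _ => by simp [hsum])

/-- Exponential tail bound for sums of i.i.d. variables with negative mean. -/
lemma exists_tail_le_pow {Z : Type*} [Fintype Z] (p h : Z → ℝ) (hp : ∀ z, 0 ≤ p z)
    (hsum : ∑ z, p z = 1) (hneg : ∑ z, p z * h z < 0) :
    ∃ ρ : ℝ, 0 ≤ ρ ∧ ρ < 1 ∧ ∀ n : ℕ,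
      ∑ z : Fin n → Z, (if 0 ≤ ∑ i, h (z i) then ∏ i, p (z i) else 0) ≤ ρ ^ n := by
  set δ := -∑ z, p z * h z with hδ
  have hδ0 : 0 < δ := by linarith
  set K := 1 + δ + ∑ z, |h z| with hK
  have hKs : 0 ≤ ∑ z, |h z| := Finset.sum_nonneg fun _ _ => abs_nonneg _
  have hK0 : 0 < K := by linarith
  have hhK : ∀ z, |h z| ≤ K := fun z => by
    have := Finset.single_le_sum (f := fun z => |h z|) (fun _ _ => abs_nonneg _) (Finset.mem_univ z)
    linarith
  set s := δ / (2 * K ^ 2) with hs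
  have hs0 : 0 < s := by positivity
  have hsK : s * K ≤ 1 := by
    rw [hs, div_mul_eq_mul_div, div_le_one (by positivity)]
    nlinarith
  have hsd : s * K ^ 2 = δ / 2 := by rw [hs]; field_simp
  refine ⟨∑ z, p z * exp (s * h z), Finset.sum_nonneg fun z _ => by have := hp z; positivity, ?_, ?_⟩
  · have hz : ∀ z, p z * exp (s * h z) ≤ p z + s * (p z * h z) + (s * K) ^ 2 * p z := by
      intro z
      have h1 : |s * h z| ≤ s * K := by
        rw [abs_mul, abs_of_pos hs0]
        exact mul_le_mul_of_nonneg_left (hhK z) hs0.le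
      have h2 := (abs_le.1 (abs_exp_sub_one_sub_id_le (h1.trans hsK))).2
      have h3 : (s * h z) ^ 2 ≤ (s * K) ^ 2 := sq_le_sq' (abs_le.1 h1).1 (abs_le.1 h1).2
      have h4 : exp (s * h z) ≤ 1 + s * h z + (s * K) ^ 2 := by linarith
      nlinarith [mul_le_mul_of_nonneg_left h4 (hp z)]
    calc _ ≤ ∑ z, (p z + s * (p z * h z) + (s * K) ^ 2 * p z) := Finset.sum_le_sum fun z _ => hz z
      _ = 1 - s * δ + s * (s * K ^ 2) := by
        simp only [Finset.sum_add_distrib, ← Finset.mul_sum, hsum, hδ]; ring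
      _ < 1 := by rw [hsd]; nlinarith
  · intro n
    rw [Fintype.sum_pow]
    refine Finset.sum_le_sum fun z _ => ?_
    rw [Finset.prod_mul_distrib, ← exp_sum, ← Finset.mul_sum]
    have hpz : 0 ≤ ∏ i, p (z i) := Finset.prod_nonneg fun _ _ => hp _
    split_ifs with hc
    · exact le_mul_of_one_le_right hpz (one_le_exp (mul_nonneg hs0.le hc))
    · positivity

/-- One-shot covering lemma, proved by random coding. -/
lemma exists_covering {α β : Type*} [Fintype α] [Fintype β] (p : α → β → ℝ)
    (hp : ∀ a b, 0 ≤ p a b) (hsum : ∑ a, ∑ b, p a b = 1) (S : α → β → Prop)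
    [∀ a b, Decidable (S a b)] (γ : ℝ)
    (hS : ∀ a b, S a b → p a b ≤ exp γ * ((∑ b', p a b') * ∑ a', p a' b)) (M : ℕ) :
    ∃ c : Fin M → β, ∑ a, (if ∀ w, ¬ S a (c w) then ∑ b, p a b else 0) ≤
      ∑ a, ∑ b, (if S a b then 0 else p a b) + exp (-(M * exp (-γ))) := by
  set q : β → ℝ := fun b => ∑ a, p a b with hq
  have hq0 : ∀ b, 0 ≤ q b := fun b => Finset.sum_nonneg fun _ _ => hp _ _
  have hq1 : ∑ b, q b = 1 := by rw [← hsum, Finset.sum_comm]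
  set W : (Fin M → β) → ℝ := fun c => ∏ w, q (c w) with hW
  have hW0 : ∀ c, 0 ≤ W c := fun c => Finset.prod_nonneg fun _ _ => hq0 _
  have hW1 : ∑ c, W c = 1 := by rw [hW, ← Fintype.sum_pow, hq1, one_pow]
  set T : (Fin M → β) → ℝ := fun c => ∑ a, (if ∀ w, ¬ S a (c w) then ∑ b, p a b else 0) with hT
  set B := ∑ a, ∑ b, (if S a b then 0 else p a b) + exp (-(M * exp (-γ))) with hB
  have hpoint : ∀ a, (∑ b, p a b) * (∑ b, if S a b then 0 else q b) ^ M ≤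
      ∑ b, (if S a b then 0 else p a b) + (∑ b, p a b) * exp (-(M * exp (-γ))) := by
    intro a
    set P := ∑ b, p a b with hP
    have hP0 : 0 ≤ P := Finset.sum_nonneg fun _ _ => hp _ _
    rcases hP0.eq_or_lt with h0 | h0
    · rw [← h0]
      simp only [zero_mul, add_zero]
      exact Finset.sum_nonneg fun b _ => by split_ifs <;> simp [hp]
    set R := ∑ b, (if S a b then p a b else 0) with hR
    have hRP : ∑ b, (if S a b then 0 else p a b) = P - R := by
      rw [hP, hR, ← Finset.sum_sub_distrib]
      exact Finset.sum_congr rfl fun b _ => by split_ifs <;> simp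
    have hR0 : 0 ≤ R := Finset.sum_nonneg fun b _ => by split_ifs <;> simp [hp]
    have hR1 : R ≤ P := Finset.sum_le_sum fun b _ => by split_ifs <;> simp [hp]
    have hQ : ∑ b, (if S a b then 0 else q b) ≤ 1 - exp (-γ) * (R / P) := by
      have : exp (-γ) * (R / P) ≤ ∑ b, (if S a b then q b else 0) := by
        rw [hR, Finset.sum_div, Finset.mul_sum]
        refine Finset.sum_le_sum fun b _ => ?_
        split_ifs with h
        · have h1 := hS a b h
          rw [exp_neg, ← div_eq_inv_mul, div_div, div_le_iff₀ (by positivity)]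
          linarith
        · simp
      have h2 : ∑ b, (if S a b then 0 else q b) + ∑ b, (if S a b then q b else 0) = 1 := by
        rw [← hq1, ← Finset.sum_add_distrib]
        exact Finset.sum_congr rfl fun b _ => by split_ifs <;> simp
      linarith
    have hQ0 : 0 ≤ ∑ b, (if S a b then 0 else q b) :=
      Finset.sum_nonneg fun b _ => by split_ifs <;> simp [hq0]
    set ρ := R / P with hρ
    have hρ0 : 0 ≤ ρ := by positivity
    have hρ1 : ρ ≤ 1 := (div_le_one h0).2 hR1
    have hpow : (∑ b, if S a b then 0 else q b) ^ M ≤ 1 - ρ + exp (-(M * exp (-γ))) := by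
      calc _ ≤ (exp (-(exp (-γ) * ρ))) ^ M :=
            pow_le_pow_left₀ hQ0 (hQ.trans (one_sub_le_exp_neg _)) _
        _ = exp ((1 - ρ) * 0 + ρ * (-(M * exp (-γ)))) := by rw [← exp_nat_mul]; congr 1; ring
        _ ≤ (1 - ρ) * exp 0 + ρ * exp (-(M * exp (-γ))) := by
            have := convexOn_exp.2 (Set.mem_univ (0 : ℝ)) (Set.mem_univ (-(M * exp (-γ))))
              (sub_nonneg.2 hρ1) hρ0 (by ring)
            simpa using this
        _ ≤ _ := by
            have := mul_le_mul_of_nonneg_right hρ1 (exp_pos (-(M * exp (-γ)))).le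
            rw [exp_zero]; linarith
    calc _ ≤ P * (1 - ρ + exp (-(M * exp (-γ)))) := mul_le_mul_of_nonneg_left hpow hP0
      _ = _ := by
        rw [hRP, mul_add, mul_sub, hρ, mul_div_cancel₀ _ h0.ne']; ring
  have havg : ∑ c, W c * T c ≤ B := by
    calc ∑ c, W c * T c = ∑ a, (∑ b, p a b) * (∑ b, if S a b then 0 else q b) ^ M := by
          simp only [hT, Finset.mul_sum (s := (Finset.univ : Finset α))]
          rw [Finset.sum_comm]
          refine Finset.sum_congr rfl fun a _ => ?_
          rw [Fintype.sum_pow, Finset.mul_sum]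
          refine Finset.sum_congr rfl fun c _ => ?_
          split_ifs with h
          · simp [h, hW, mul_comm]
          · push Not at h
            obtain ⟨w, hw⟩ := h
            rw [Finset.prod_eq_zero (Finset.mem_univ w) (by simp [hw])]
            simp
      _ ≤ ∑ a, (∑ b, (if S a b then 0 else p a b) + (∑ b, p a b) * exp (-(M * exp (-γ)))) :=
          Finset.sum_le_sum fun a _ => hpoint a
      _ = B := by rw [Finset.sum_add_distrib, ← Finset.sum_mul, hsum, one_mul]
  by_contra! hcon
  have hle : ∀ c ∈ Finset.univ, W c * B ≤ W c * T c := fun c _ =>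
    mul_le_mul_of_nonneg_left (hcon c).le (hW0 c)
  have hsumB : ∑ c, W c * B = B := by rw [← Finset.sum_mul, hW1, one_mul]
  have heq := (Finset.sum_eq_sum_iff_of_le hle).1
    (le_antisymm (Finset.sum_le_sum hle) (by rw [hsumB]; exact havg))
  have : ∀ c, W c = 0 := fun c => by
    have h1 := heq c (Finset.mem_univ c)
    have h2 : B < T c := hcon c
    by_contra h3
    exact h2.ne (mul_left_cancel₀ h3 h1)
  simp [this] at hW1

/-- Achievability in rate–distortion theory: a code of rate close to `info p` attains, on average,
almost the reward `∑ a, ∑ b, p a b * g a b`. -/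
lemma exists_quantizer {α β : Type*} [Fintype α] [Fintype β] (p g : α → β → ℝ)
    (hp : ∀ a b, 0 ≤ p a b) (hsum : ∑ a, ∑ b, p a b = 1) {ε : ℝ} (hε : 0 < ε) :
    ∃ n : ℕ, 0 < n ∧ ∃ (m : ℕ) (f : (Fin n → α) → Fin (m + 1)) (c : Fin (m + 1) → Fin n → β),
      log (m + 1) ≤ n * (info p + ε) ∧
      n * (∑ a, ∑ b, p a b * g a b - ε) ≤
        ∑ x : Fin n → α, (∏ i, ∑ b, p (x i) b) * ∑ i, g (x i) (c (f x) i) := by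
  classical
  set J := info p with hJ
  set G := ∑ a, ∑ b, p a b * g a b with hG
  have hJ0 : 0 ≤ J := info_nonneg p hp hsum
  set K := |G| + ∑ a, ∑ b, |g a b| with hK
  have hgK0 : 0 ≤ ∑ a, ∑ b, |g a b| :=
    Finset.sum_nonneg fun _ _ => Finset.sum_nonneg fun _ _ => abs_nonneg _
  have hK0 : 0 ≤ K := by positivity
  have hGK : G ≤ K := by linarith [le_abs_self G]
  have hgK : ∀ a b, -K ≤ g a b := fun a b => by
    have h1 := Finset.single_le_sum (f := fun b => |g a b|) (fun _ _ => abs_nonneg _)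
      (Finset.mem_univ b)
    have h2 := Finset.single_le_sum (f := fun a => ∑ b, |g a b|)
      (fun _ _ => Finset.sum_nonneg fun _ _ => abs_nonneg _) (Finset.mem_univ a)
    linarith [neg_abs_le (g a b), abs_nonneg G]
  set ι : α → β → ℝ := fun a b =>
    log (p a b) - log (∑ b', p a b') - log (∑ a', p a' b) with hι
  have hmean : ∑ a, ∑ b, p a b * ι a b = J := (info_eq_sum_log p).symm
  have hsumz : ∑ z : α × β, p z.1 z.2 = 1 := by rw [Fintype.sum_prod_type, ← hsum]
  obtain ⟨ρ₁, hρ₁0, hρ₁1, htail₁⟩ := exists_tail_le_pow (fun z : α × β => p z.1 z.2)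
    (fun z => ι z.1 z.2 - (J + ε / 2)) (fun z => hp _ _) hsumz (by
      simp only [mul_sub, Finset.sum_sub_distrib, ← Finset.sum_mul, hsumz]
      rw [Fintype.sum_prod_type, hmean]
      linarith)
  obtain ⟨ρ₂, hρ₂0, hρ₂1, htail₂⟩ := exists_tail_le_pow (fun z : α × β => p z.1 z.2)
    (fun z => (G - ε / 2) - g z.1 z.2) (fun z => hp _ _) hsumz (by
      simp only [mul_sub (p _ _) (_ - _), Finset.sum_sub_distrib, ← Finset.sum_mul, hsumz]
      rw [Fintype.sum_prod_type, ← hG]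
      linarith)
  have hlim : Filter.Tendsto
      (fun n : ℕ => 2 * K * (ρ₁ ^ n + ρ₂ ^ n + exp (-(n * (ε / 4))))) Filter.atTop (nhds 0) := by
    have h3 : Filter.Tendsto (fun n : ℕ => exp (-(n * (ε / 4)))) Filter.atTop (nhds 0) :=
      tendsto_exp_neg_atTop_nhds_zero.comp
        (tendsto_natCast_atTop_atTop.atTop_mul_const (by positivity))
    simpa using (((tendsto_pow_atTop_nhds_zero_of_lt_one hρ₁0 hρ₁1).add
      (tendsto_pow_atTop_nhds_zero_of_lt_one hρ₂0 hρ₂1)).add h3).const_mul (2 * K)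
  obtain ⟨n, hn, hn0⟩ := ((hlim.eventually_lt_const (half_pos hε)).and
    (Filter.eventually_gt_atTop 0)).exists
  have hnR : (0 : ℝ) < n := by exact_mod_cast hn0
  set E := exp (n * (J + ε)) with hE
  have hE1 : 1 ≤ E := one_le_exp (by positivity)
  obtain ⟨m, hm⟩ : ∃ m, ⌊E⌋₊ = m + 1 :=
    Nat.exists_eq_succ_of_ne_zero (Nat.floor_pos.2 hE1).ne'
  have hmE : (m + 1 : ℝ) ≤ E := by
    have := Nat.floor_le (zero_le_one.trans hE1)
    rw [hm] at this
    exact_mod_cast this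
  have hmE2 : E / 2 ≤ (m + 1 : ℝ) := by
    have := Nat.lt_floor_add_one E
    rw [hm] at this
    push_cast at this
    have : (0 : ℝ) ≤ m := m.cast_nonneg
    linarith
  set pn : (Fin n → α) → (Fin n → β) → ℝ := fun x u => ∏ i, p (x i) (u i) with hpn
  have hpn0 : ∀ x u, 0 ≤ pn x u := fun x u => Finset.prod_nonneg fun _ _ => hp _ _
  have hmarg : ∀ x, ∑ u, pn x u = ∏ i, ∑ b, p (x i) b := fun x =>
    (Fintype.prod_sum fun i b => p (x i) b).symm
  have hmarg' : ∀ u, ∑ x, pn x u = ∏ i, ∑ a, p a (u i) := fun u =>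
    (Fintype.prod_sum fun i a => p a (u i)).symm
  have hpnsum : ∑ x, ∑ u, pn x u = 1 := by
    simp only [hmarg]
    rw [← Fintype.sum_pow (fun a => ∑ b, p a b), hsum, one_pow]
  set S : (Fin n → α) → (Fin n → β) → Prop := fun x u =>
    ¬ 0 ≤ ∑ i, (ι (x i) (u i) - (J + ε / 2)) ∧ ¬ 0 ≤ ∑ i, ((G - ε / 2) - g (x i) (u i)) with hSdef
  set γ := n * (J + ε / 2) with hγ
  have hS : ∀ x u, S x u → pn x u ≤ exp γ * ((∑ u', pn x u') * ∑ x', pn x' u) := by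
    intro x u hxu
    rcases (hpn0 x u).eq_or_lt with h0 | h0
    · rw [← h0]
      exact mul_nonneg (exp_pos _).le (mul_nonneg (Finset.sum_nonneg fun _ _ => hpn0 _ _)
        (Finset.sum_nonneg fun _ _ => hpn0 _ _))
    · have hpos : ∀ i, 0 < p (x i) (u i) := fun i => (hp _ _).lt_of_ne' fun h =>
        h0.ne' (Finset.prod_eq_zero (Finset.mem_univ i) h)
      have hposA : ∀ i, 0 < ∑ b, p (x i) b := fun i => (hpos i).trans_le
        (Finset.single_le_sum (f := fun b => p (x i) b) (fun _ _ => hp _ _) (Finset.mem_univ _))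
      have hposB : ∀ i, 0 < ∑ a, p a (u i) := fun i => (hpos i).trans_le
        (Finset.single_le_sum (f := fun a => p a (u i)) (fun _ _ => hp _ _) (Finset.mem_univ _))
      rw [hmarg, hmarg', show pn x u = ∏ i, p (x i) (u i) from rfl]
      have hexp : ∀ v : Fin n → ℝ, (∀ i, 0 < v i) → ∏ i, v i = exp (∑ i, log (v i)) :=
        fun v hv => by rw [exp_sum]; exact Finset.prod_congr rfl fun i _ => (exp_log (hv i)).symm
      rw [hexp _ hpos, hexp _ hposA, hexp _ hposB, ← exp_add, ← exp_add, exp_le_exp]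
      have := (not_le.1 hxu.1).le
      simp only [hι, Finset.sum_sub_distrib, Finset.sum_const, Finset.card_univ, Fintype.card_fin,
        nsmul_eq_mul] at this
      linarith
  obtain ⟨c, hc⟩ := exists_covering pn hpn0 hpnsum S γ hS (m + 1)
  have hbad : ∑ x, ∑ u, (if S x u then 0 else pn x u) ≤ ρ₁ ^ n + ρ₂ ^ n := by
    refine le_trans ?_ (add_le_add (htail₁ n) (htail₂ n))
    rw [← Finset.sum_add_distrib, ← (Equiv.arrowProdEquivProdArrow (Fin n) (fun _ => α)
      (fun _ => β)).symm.sum_comp, Fintype.sum_prod_type]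
    refine Finset.sum_le_sum fun x _ => Finset.sum_le_sum fun u _ => ?_
    simp only [Equiv.arrowProdEquivProdArrow, Equiv.coe_fn_symm_mk]
    have h0 := hpn0 x u
    simp only [hpn] at h0 ⊢
    by_cases h1 : 0 ≤ ∑ i, (ι (x i) (u i) - (J + ε / 2)) <;>
      by_cases h2 : 0 ≤ ∑ i, ((G - ε / 2) - g (x i) (u i)) <;>
      simp only [hSdef, h1, h2, if_true, if_false, not_true, not_false_iff, and_self, and_true,
        and_false, add_zero, zero_add] <;> linarith
  have hexp : exp (-(((m + 1 : ℕ) : ℝ) * exp (-γ))) ≤ exp (-(n * (ε / 4))) := by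
    rw [exp_le_exp, neg_le_neg_iff]
    push_cast
    calc n * (ε / 4) ≤ exp (n * (ε / 2)) / 2 := by linarith [add_one_le_exp (n * (ε / 2))]
      _ = E / 2 * exp (-γ) := by
        rw [hE, hγ, div_mul_eq_mul_div, ← exp_add]; congr 2; ring
      _ ≤ _ := mul_le_mul_of_nonneg_right hmE2 (exp_pos _).le
  set f : (Fin n → α) → Fin (m + 1) := fun x =>
    if h : ∃ w, S x (c w) then h.choose else 0 with hf
  refine ⟨n, hn0, m, f, c, ?_, ?_⟩
  · rw [log_le_iff_le_exp (by positivity)]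
    exact hmE
  · set D : (Fin n → α) → ℝ := fun x => if ∀ w, ¬ S x (c w) then ∑ u, pn x u else 0 with hD
    have hDsum : ∑ x, D x ≤ ρ₁ ^ n + ρ₂ ^ n + exp (-(n * (ε / 4))) := by
      refine hc.trans (add_le_add hbad hexp)
    have hx : ∀ x, (∑ u, pn x u) * (n * (G - ε / 2)) - 2 * K * n * D x ≤
        (∏ i, ∑ b, p (x i) b) * ∑ i, g (x i) (c (f x) i) := by
      intro x
      rw [← hmarg]
      have hP0 : 0 ≤ ∑ u, pn x u := Finset.sum_nonneg fun _ _ => hpn0 _ _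
      by_cases h : ∃ w, S x (c w)
      · have hDx : D x = 0 := if_neg (by push Not; exact h)
        have hfx : S x (c (f x)) := by
          simp only [hf, dif_pos h]
          exact h.choose_spec
        have h2 := (not_le.1 hfx.2).le
        simp only [Finset.sum_sub_distrib, Finset.sum_const, Finset.card_univ, Fintype.card_fin,
          nsmul_eq_mul] at h2
        rw [hDx, mul_zero, sub_zero]
        exact mul_le_mul_of_nonneg_left (by linarith) hP0
      · have hDx : D x = ∑ u, pn x u := if_pos (by push Not at h; exact h)
        have h2 : ∑ _i : Fin n, -K ≤ ∑ i, g (x i) (c (f x) i) :=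
          Finset.sum_le_sum fun i _ => hgK _ _
        simp only [Finset.sum_const, Finset.card_univ, Fintype.card_fin, nsmul_eq_mul] at h2
        have h3 : n * (G - ε / 2) - 2 * K * n ≤ ∑ i, g (x i) (c (f x) i) := by nlinarith
        rw [hDx]
        linarith [mul_le_mul_of_nonneg_left h3 hP0]
    refine le_trans ?_ (Finset.sum_le_sum fun x _ => hx x)
    rw [Finset.sum_sub_distrib, ← Finset.sum_mul, ← Finset.mul_sum, hpnsum]
    have := mul_le_mul_of_nonneg_left hDsum (by positivity : 0 ≤ 2 * K)
    nlinarith [mul_le_mul_of_nonneg_left (this.trans hn.le) hnR.le]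

lemma sum_prod_mul_apply {ι β : Type*} [Fintype ι] [DecidableEq ι] [Fintype β] (a : ι → β → ℝ)
    (φ : β → ℝ) (i : ι) :
    ∑ y : ι → β, (∏ j, a j (y j)) * φ (y i) =
      (∑ b, a i b * φ b) * ∏ j ∈ Finset.univ.erase i, ∑ b, a j b := by
  have h : ∀ y : ι → β, (∏ j, a j (y j)) * φ (y i) =
      ∏ j, (a j (y j) * if j = i then φ (y j) else 1) := fun y => by
    rw [Finset.prod_mul_distrib, Finset.prod_ite_eq' Finset.univ i fun j => φ (y j)]
    simp
  simp only [h]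
  rw [← Fintype.prod_sum fun j b => a j b * if j = i then φ b else 1,
    ← Finset.mul_prod_erase _ _ (Finset.mem_univ i)]
  congr 1
  · simp
  · refine Finset.prod_congr rfl fun j hj => ?_
    simp [Finset.ne_of_mem_erase hj]

/-- The inner bound in terms of mass functions: `a` is the joint law of `(X, Y)`, `p` that of
`(X, U)`, and `r` that of `(Y, U)` when `Y` and `U` are conditionally independent given `X`. -/
lemma exists_encoder {α β η : Type*} [Fintype α] [Fintype β] [Fintype η]
    (a : α → η → ℝ) (p : α → β → ℝ) (r : η → β → ℝ)
    (ha : ∀ x y, 0 ≤ a x y) (hp : ∀ x u, 0 ≤ p x u) (hsum : ∑ x, ∑ u, p x u = 1)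
    (hmarg : ∀ x, ∑ y, a x y = ∑ u, p x u)
    (hr : ∀ y u, r y u = ∑ x, a x y * p x u / ∑ u', p x u') {ε : ℝ} (hε : 0 < ε) :
    ∃ n : ℕ, 0 < n ∧ ∃ (m : ℕ) (f : (Fin n → α) → Fin (m + 1)),
      log (m + 1) ≤ n * (info p + ε) ∧
      n * (info r - ε) ≤ info (fun (y : Fin n → η) (w : Fin (m + 1)) =>
        ∑ x : Fin n → α, if f x = w then ∏ i, a (x i) (y i) else 0) := by
  classical
  set P : α → ℝ := fun x => ∑ u, p x u with hP
  have hP0 : ∀ x, 0 ≤ P x := fun x => Finset.sum_nonneg fun _ _ => hp _ _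
  have haP : ∀ x y, P x = 0 → a x y = 0 := fun x y h =>
    (Finset.sum_eq_zero_iff_of_nonneg fun _ _ => ha _ _).1 ((hmarg x).trans h) y
      (Finset.mem_univ y)
  have hr0 : ∀ y u, 0 ≤ r y u := fun y u => by
    rw [hr]
    exact Finset.sum_nonneg fun x _ => div_nonneg (mul_nonneg (ha _ _) (hp _ _)) (hP0 x)
  have hrA : ∀ y, ∑ u, r y u = ∑ x, a x y := fun y => by
    simp only [hr]
    rw [Finset.sum_comm]
    refine Finset.sum_congr rfl fun x _ => ?_
    rw [← Finset.sum_div, ← Finset.mul_sum]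
    by_cases h : P x = 0
    · simp [haP x y h]
    · exact mul_div_cancel_right₀ _ h
  have hAsum : ∑ y, ∑ x, a x y = 1 := by
    rw [Finset.sum_comm, ← hsum]
    exact Finset.sum_congr rfl fun x _ => hmarg x
  have hrsum : ∑ y, ∑ u, r y u = 1 := by simp only [hrA, hAsum]
  set A : η → ℝ := fun y => ∑ x, a x y with hA
  have hA0 : ∀ y, 0 ≤ A y := fun y => Finset.sum_nonneg fun _ _ => ha _ _
  set B : β → ℝ := fun u => ∑ y, r y u with hB
  have hB0 : ∀ u, 0 ≤ B u := fun u => Finset.sum_nonneg fun _ _ => hr0 _ _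
  set t := exp (-(ε / 2)) with ht
  have ht0 : 0 < t := exp_pos _
  have ht1 : t < 1 := exp_lt_one_iff.2 (by linarith)
  set l : η → β → ℝ := fun y u => t * (r y u / (A y * B u)) + (1 - t) with hl
  have hq0 : ∀ y u, 0 ≤ r y u / (A y * B u) := fun y u =>
    div_nonneg (hr0 _ _) (mul_nonneg (hA0 _) (hB0 _))
  have hl0 : ∀ y u, 0 < l y u := fun y u =>
    add_pos_of_nonneg_of_pos (mul_nonneg ht0.le (hq0 y u)) (by linarith)
  have hl1 : ∀ u, ∑ y, A y * l y u ≤ 1 := by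
    intro u
    have h1 : ∀ y, A y * (r y u / (A y * B u)) ≤ r y u / B u := fun y => by
      rcases (hA0 y).eq_or_lt with h | h
      · rw [← h]; simpa using div_nonneg (hr0 y u) (hB0 u)
      · rw [← div_div, div_right_comm, mul_div_cancel₀ _ h.ne']
    have h2 : ∑ y, A y * (r y u / (A y * B u)) ≤ 1 := by
      refine (Finset.sum_le_sum fun y _ => h1 y).trans ?_
      rw [← Finset.sum_div]
      exact div_self_le_one _
    calc ∑ y, A y * l y u = t * ∑ y, A y * (r y u / (A y * B u)) + (1 - t) * ∑ y, A y := by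
          rw [Finset.mul_sum, Finset.mul_sum, ← Finset.sum_add_distrib]
          exact Finset.sum_congr rfl fun y _ => by simp only [hl]; ring
      _ ≤ t * 1 + (1 - t) * 1 := by
          rw [show ∑ y, A y = 1 from hAsum]
          linarith [mul_le_mul_of_nonneg_left h2 ht0.le]
      _ = 1 := by ring
  set g : α → β → ℝ := fun x u => (∑ y, a x y * log (l y u)) / P x with hg
  have hPg : ∀ x u, P x * g x u = ∑ y, a x y * log (l y u) := fun x u => by
    by_cases h : P x = 0
    · simp [h, haP x _ h]
    · exact mul_div_cancel₀ _ h
  have hreward : info r - ε / 2 ≤ ∑ x, ∑ u, p x u * g x u := by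
    have h1 : ∑ x, ∑ u, p x u * g x u = ∑ y, ∑ u, r y u * log (l y u) := by
      simp only [hr, Finset.sum_mul]
      calc _ = ∑ x, ∑ u, ∑ y, a x y * p x u / P x * log (l y u) :=
            Finset.sum_congr rfl fun x _ => Finset.sum_congr rfl fun u _ => by
              rw [hg, mul_div_assoc', Finset.mul_sum, Finset.sum_div]
              exact Finset.sum_congr rfl fun y _ => by ring
        _ = ∑ u, ∑ x, ∑ y, a x y * p x u / P x * log (l y u) := Finset.sum_comm
        _ = ∑ u, ∑ y, ∑ x, a x y * p x u / P x * log (l y u) :=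
            Finset.sum_congr rfl fun u _ => Finset.sum_comm
        _ = _ := Finset.sum_comm
    have h2 : ∀ y u, r y u * (log (r y u) - log (A y) - log (B u)) - ε / 2 * r y u ≤
        r y u * log (l y u) := fun y u => by
      rcases (hr0 y u).eq_or_lt with h | h
      · simp [← h]
      · have hAy : 0 < A y := h.trans_le ((Finset.single_le_sum (f := fun u => r y u)
          (fun _ _ => hr0 _ _) (Finset.mem_univ u)).trans (hrA y).le)
        have hBu : 0 < B u := h.trans_le
          (Finset.single_le_sum (f := fun y => r y u) (fun _ _ => hr0 _ _) (Finset.mem_univ y))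
        have h3 : log (t * (r y u / (A y * B u))) ≤ log (l y u) :=
          log_le_log (by positivity) (by simp only [hl]; linarith)
        rw [log_mul ht0.ne' (by positivity), log_div h.ne' (by positivity),
          log_mul hAy.ne' hBu.ne', ht, log_exp] at h3
        have := mul_le_mul_of_nonneg_left h3 h.le
        linarith
    rw [h1, info_eq_sum_log]
    simp only [hrA]
    have h3 := Finset.sum_le_sum fun y (_ : y ∈ Finset.univ) =>
      Finset.sum_le_sum fun u (_ : u ∈ Finset.univ) => h2 y u
    simp only [Finset.sum_sub_distrib (f := fun u => r _ u * _), Finset.sum_sub_distrib,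
      ← Finset.mul_sum, hrsum] at h3
    linarith
  obtain ⟨n, hn, m, f, c, hrate, hrew⟩ := exists_quantizer p g hp hsum (half_pos hε)
  have hnR : (0 : ℝ) < n := by exact_mod_cast hn
  refine ⟨n, hn, m, f, hrate.trans (mul_le_mul_of_nonneg_left (by linarith) hnR.le), ?_⟩
  set s : (Fin n → η) → Fin (m + 1) → ℝ := fun y w =>
    ∑ x : Fin n → α, if f x = w then ∏ i, a (x i) (y i) else 0 with hs
  have hs0 : ∀ y w, 0 ≤ s y w := fun y w => Finset.sum_nonneg fun x _ => by
    split_ifs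
    · exact Finset.prod_nonneg fun _ _ => ha _ _
    · exact le_rfl
  have hsw : ∀ (y : Fin n → η) (φ : Fin (m + 1) → ℝ),
      ∑ w, s y w * φ w = ∑ x : Fin n → α, (∏ i, a (x i) (y i)) * φ (f x) := fun y φ => by
    simp only [hs, Finset.sum_mul]
    rw [Finset.sum_comm]
    exact Finset.sum_congr rfl fun x _ => by simp
  have hsA : ∀ y, ∑ w, s y w = ∏ i, A (y i) := fun y => by
    have := hsw y fun _ => 1
    simp only [mul_one] at this
    rw [this, ← Fintype.prod_sum fun i x => a x (y i)]
  have hssum : ∑ y, ∑ w, s y w = 1 := by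
    simp only [hsA]
    rw [← Fintype.sum_pow, show ∑ y, A y = 1 from hAsum, one_pow]
  have hmain := sum_mul_log_le_info s (fun y w => ∏ i, l (y i) (c w i)) hs0 hssum
    (fun y w => Finset.prod_pos fun _ _ => hl0 _ _) (fun w => by
      simp only [hsA, ← Finset.prod_mul_distrib]
      rw [← Fintype.prod_sum fun i y => A y * l y (c w i)]
      exact Finset.prod_le_one (fun i _ => Finset.sum_nonneg fun y _ =>
        mul_nonneg (hA0 _) (hl0 _ _).le) fun i _ => hl1 _)
  refine le_trans ?_ hmain
  calc n * (info r - ε) ≤ n * (∑ x, ∑ u, p x u * g x u - ε / 2) :=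
        mul_le_mul_of_nonneg_left (by linarith) hnR.le
    _ ≤ _ := hrew
    _ = ∑ x : Fin n → α, ∑ i, ∑ y : Fin n → η,
          (∏ j, a (x j) (y j)) * log (l (y i) (c (f x) i)) := by
        refine Finset.sum_congr rfl fun x _ => ?_
        rw [Finset.mul_sum]
        refine Finset.sum_congr rfl fun i _ => ?_
        rw [sum_prod_mul_apply (fun j y => a (x j) y) (fun y => log (l y (c (f x) i))) i, ← hPg,
          ← Finset.mul_prod_erase _ _ (Finset.mem_univ i)]
        simp only [hmarg]
        ring
    _ = _ := by
        have hlog : ∀ y : Fin n → η, ∑ w, s y w * log (∏ i, l (y i) (c w i)) =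
            ∑ x : Fin n → α, ∑ i, (∏ j, a (x j) (y j)) * log (l (y i) (c (f x) i)) := fun y => by
          rw [hsw y fun w => log (∏ i, l (y i) (c w i))]
          refine Finset.sum_congr rfl fun x _ => ?_
          rw [log_prod fun i _ => (hl0 _ _).ne', Finset.mul_sum]
        simp only [hlog]
        rw [Finset.sum_comm (s := (Finset.univ : Finset (Fin n → η)))]
        exact Finset.sum_congr rfl fun x _ => Finset.sum_comm

lemma measureReal_eq_sum_inter {Ω α : Type*} [MeasurableSpace Ω] [Fintype α] [MeasurableSpace α]
    [MeasurableSingletonClass α] (μ : Measure Ω) [IsFiniteMeasure μ] {A : Ω → α}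
    (hA : Measurable A) (T : Set Ω) : μ.real T = ∑ a, μ.real (T ∩ A ⁻¹' {a}) := by
  have h := sum_measureReal_preimage_singleton (μ := μ.restrict T) Finset.univ
    (f := A) fun a _ => hA (measurableSet_singleton a)
  simp only [Finset.coe_univ, Set.preimage_univ] at h
  rw [measureReal_restrict_apply_univ] at h
  rw [← h]
  exact Finset.sum_congr rfl fun a _ => by
    rw [measureReal_restrict_apply (hA (measurableSet_singleton a)), Set.inter_comm]

lemma miFin_eq_info {Ω α β : Type*} [MeasurableSpace Ω] [Fintype α] [MeasurableSpace α]
    [MeasurableSingletonClass α] [Fintype β] [MeasurableSpace β] [MeasurableSingletonClass β]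
    (μ : Measure Ω) [IsFiniteMeasure μ] {A : Ω → α} {B : Ω → β} (hA : Measurable A)
    (hB : Measurable B) :
    miFin μ A B = info fun a b => μ.real (A ⁻¹' {a} ∩ B ⁻¹' {b}) := by
  have h1 : ∀ a, ∑ b, μ.real (A ⁻¹' {a} ∩ B ⁻¹' {b}) = μ.real (A ⁻¹' {a}) := fun a =>
    (measureReal_eq_sum_inter μ hB _).symm
  have h2 : ∀ b, ∑ a, μ.real (A ⁻¹' {a} ∩ B ⁻¹' {b}) = μ.real (B ⁻¹' {b}) := fun b => by
    rw [measureReal_eq_sum_inter μ hA]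
    simp only [Set.inter_comm]
  have h3 : ∀ a b, (fun ω => (A ω, B ω)) ⁻¹' {(a, b)} = A ⁻¹' {a} ∩ B ⁻¹' {b} := fun a b => by
    ext ω; simp
  simp only [miFin, ent, info, h1, h2, Fintype.sum_prod_type, h3]
  rfl

/-- The conditional expectation of an indicator given a discrete variable `B`, on the event
`B = b`. -/
lemma exists_condExp_ind_eq {Ω β : Type*} [MeasurableSpace Ω] [MeasurableSpace β]
    [MeasurableSingletonClass β] (μ : Measure Ω) [IsProbabilityMeasure μ] {B : Ω → β}
    (hB : Measurable B) {T : Set Ω} (hT : MeasurableSet T) (b : β) :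
    ∃ v : ℝ, (∀ ω ∈ B ⁻¹' {b}, (μ[ind T | MeasurableSpace.comap B inferInstance]) ω = v) ∧
      v * μ.real (B ⁻¹' {b}) = μ.real (T ∩ B ⁻¹' {b}) := by
  obtain ⟨φ, -, hφ⟩ := (stronglyMeasurable_condExp (μ := μ) (f := ind T)
    (m := MeasurableSpace.comap B inferInstance)).exists_eq_measurable_comp
  have hv : ∀ ω ∈ B ⁻¹' {b}, (μ[ind T | MeasurableSpace.comap B inferInstance]) ω = φ b := by
    intro ω hω
    rw [hφ, Function.comp_apply, show B ω = b from hω]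
  refine ⟨φ b, hv, ?_⟩
  have hs : MeasurableSet (B ⁻¹' {b}) := hB (measurableSet_singleton b)
  have h : ∫ ω in B ⁻¹' {b}, (μ[ind T | MeasurableSpace.comap B inferInstance]) ω ∂μ =
      ∫ ω in B ⁻¹' {b}, ind T ω ∂μ := setIntegral_condExp hB.comap_le
    (((integrable_const (1 : ℝ)).indicator hT : Integrable (ind T) μ))
    (⟨{b}, measurableSet_singleton b, rfl⟩ :
      MeasurableSet[MeasurableSpace.comap B inferInstance] (B ⁻¹' {b}))
  rw [setIntegral_congr_fun hs hv, setIntegral_const, ind, integral_indicator_const _ hT,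
    measureReal_restrict_apply hT] at h
  simpa [mul_comm] using h

lemma Markov.measureReal_mul {Ω α β γ : Type*} [MeasurableSpace Ω] [MeasurableSpace α]
    [MeasurableSingletonClass α] [MeasurableSpace β] [MeasurableSingletonClass β]
    [MeasurableSpace γ] [MeasurableSingletonClass γ] {μ : Measure Ω} [IsProbabilityMeasure μ]
    {A : Ω → α} {B : Ω → β} {C : Ω → γ} (h : Markov μ A B C) (hA : Measurable A)
    (hB : Measurable B) (hC : Measurable C) (a : α) (b : β) (c : γ) :
    μ.real (A ⁻¹' {a} ∩ C ⁻¹' {c} ∩ B ⁻¹' {b}) * μ.real (B ⁻¹' {b}) =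
      μ.real (A ⁻¹' {a} ∩ B ⁻¹' {b}) * μ.real (C ⁻¹' {c} ∩ B ⁻¹' {b}) := by
  have hAa := hA (measurableSet_singleton a)
  have hCc := hC (measurableSet_singleton c)
  obtain ⟨v₁, hv₁, h₁⟩ := exists_condExp_ind_eq μ hB (hAa.inter hCc) b
  obtain ⟨v₂, hv₂, h₂⟩ := exists_condExp_ind_eq μ hB hAa b
  obtain ⟨v₃, hv₃, h₃⟩ := exists_condExp_ind_eq μ hB hCc b
  rw [← h₁, ← h₂, ← h₃]
  by_cases hb : μ (B ⁻¹' {b}) = 0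
  · simp [Measure.real, hb]
  · have hfreq : ∃ᵐ ω ∂μ, ω ∈ B ⁻¹' {b} := frequently_ae_mem_iff.2 hb
    obtain ⟨ω, hω, heq⟩ := (hfreq.and_eventually
      (h {a} {c} (measurableSet_singleton a) (measurableSet_singleton c))).exists
    have hv : v₁ = v₂ * v₃ := by
      rw [← hv₁ ω hω, ← hv₂ ω hω, ← hv₃ ω hω]
      exact heq
    rw [hv]
    ring

/-- discrete inner bound, Lemma 5 of the paper: for finite alphabets and a
Markov chain `Y ⊸ X ⊸ U`, for every `ε > 0` there are `n` and `f : 𝒳ⁿ → M` with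
`(1/n) log |M| ≤ I(X;U) + ε` and `(1/n) I(Yⁿ; f(Xⁿ)) ≥ I(Y;U) − ε`. -/
theorem discrete_inner_bound
    {Ω 𝒴 𝒳 𝒰 : Type*} [MeasurableSpace Ω]
    [Fintype 𝒴] [MeasurableSpace 𝒴] [MeasurableSingletonClass 𝒴]
    [Fintype 𝒳] [MeasurableSpace 𝒳] [MeasurableSingletonClass 𝒳]
    [Fintype 𝒰] [MeasurableSpace 𝒰] [MeasurableSingletonClass 𝒰]
    (μ : Measure Ω) [IsProbabilityMeasure μ]
    (Y : Ω → 𝒴) (X : Ω → 𝒳) (U : Ω → 𝒰)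
    (hY : Measurable Y) (hX : Measurable X) (hU : Measurable U)
    (hMarkov : Markov μ Y X U) (ε : ℝ) (hε : 0 < ε) :
    ∃ n : ℕ, 0 < n ∧ ∃ (m : ℕ) (f : (Fin n → 𝒳) → Fin (m + 1)),
      Real.log (m + 1) ≤ n * (miFin μ X U + ε) ∧
      n * (miFin μ Y U - ε) ≤
        miFin (Measure.pi fun _ : Fin n => μ)
          (fun ω i => Y (ω i)) (fun ω => f fun i => X (ω i)) := by
  set a : 𝒳 → 𝒴 → ℝ := fun x y => μ.real (Y ⁻¹' {y} ∩ X ⁻¹' {x}) with ha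
  set p : 𝒳 → 𝒰 → ℝ := fun x u => μ.real (X ⁻¹' {x} ∩ U ⁻¹' {u}) with hp
  set r : 𝒴 → 𝒰 → ℝ := fun y u => μ.real (Y ⁻¹' {y} ∩ U ⁻¹' {u}) with hr
  have hpX : ∀ x, ∑ u, p x u = μ.real (X ⁻¹' {x}) := fun x =>
    (measureReal_eq_sum_inter μ hU _).symm
  have haX : ∀ x, ∑ y, a x y = μ.real (X ⁻¹' {x}) := fun x => by
    rw [measureReal_eq_sum_inter μ hY]
    simp only [ha, Set.inter_comm]
  have hsum : ∑ x, ∑ u, p x u = 1 := by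
    simp only [hpX]
    have := measureReal_eq_sum_inter μ hX Set.univ
    simpa using this.symm
  have hfac : ∀ y u, r y u = ∑ x, a x y * p x u / ∑ u', p x u' := fun y u => by
    simp only [hr]
    rw [measureReal_eq_sum_inter μ hX]
    refine Finset.sum_congr rfl fun x _ => ?_
    have hM := hMarkov.measureReal_mul hY hX hU y x u
    rw [hpX]
    by_cases h0 : μ.real (X ⁻¹' {x}) = 0
    · rw [h0, div_zero]
      exact le_antisymm ((measureReal_mono Set.inter_subset_right).trans h0.le) measureReal_nonneg
    · rw [eq_div_iff h0, hM]
      simp only [ha, hp, Set.inter_comm]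
  obtain ⟨n, hn, m, f, hrate, hinfo⟩ := exists_encoder a p r (fun _ _ => measureReal_nonneg)
    (fun _ _ => measureReal_nonneg) hsum (fun x => (haX x).trans (hpX x).symm) hfac hε
  have hXn : Measurable fun (ω : Fin n → Ω) i => X (ω i) :=
    measurable_pi_lambda _ fun i => hX.comp (measurable_pi_apply i)
  have hYn : Measurable fun (ω : Fin n → Ω) i => Y (ω i) :=
    measurable_pi_lambda _ fun i => hY.comp (measurable_pi_apply i)
  refine ⟨n, hn, m, f, ?_, ?_⟩
  · rwa [miFin_eq_info μ hX hU]
  · rw [miFin_eq_info μ hY hU]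
    refine le_of_le_of_eq ?_ (miFin_eq_info _ hYn ((measurable_of_finite f).comp hXn)).symm
    convert hinfo using 4 with y w
    rw [measureReal_eq_sum_inter _ hXn]
    refine Finset.sum_congr rfl fun x _ => ?_
    split_ifs with hfx
    · have hset : (fun (ω : Fin n → Ω) i => Y (ω i)) ⁻¹' {y} ∩
          (f ∘ fun (ω : Fin n → Ω) i => X (ω i)) ⁻¹' {w} ∩
          (fun (ω : Fin n → Ω) i => X (ω i)) ⁻¹' {x} =
          Set.univ.pi fun i => Y ⁻¹' {y i} ∩ X ⁻¹' {x i} := by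
        ext ω
        simp only [Set.mem_inter_iff, Set.mem_preimage, Set.mem_singleton_iff, Set.mem_univ_pi,
          Function.comp_apply, funext_iff, forall_and]
        constructor
        · rintro ⟨⟨h1, -⟩, h2⟩
          exact ⟨h1, h2⟩
        · rintro ⟨h1, h2⟩
          exact ⟨⟨h1, by rw [funext h2, hfx]⟩, h2⟩
      rw [hset, Measure.real, Measure.pi_pi, ENNReal.toReal_prod]
      rfl
    · convert measureReal_empty
      ext ω
      simp only [Set.mem_inter_iff, Set.mem_preimage, Set.mem_singleton_iff, Function.comp_apply,
        Set.mem_empty_iff_false, iff_false]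
      rintro ⟨⟨-, h1⟩, h2⟩
      rw [h2] at h1
      exact hfx h1

end IB
end
end

section
/- Let Y, X, U be random variables where 𝒴 and 𝒰 are finite sets and 𝒳 is an arbitrary measurable space, such that the Markov chain Y ⊸ X ⊸ U holds. Then for any ε > 0 there exist n ∈ ℕ and a measurable function f : 𝒳^n → M with M a finite set satisfying (1/n)·log|M| ≤ I(X;U) + ε and (1/n)·I(Y^n; f(X^n)) ≥ I(Y;U) − ε, where (Y^n,X^n) are n i.i.d. copies of (Y,X). -/
open MeasureTheory Real
open scoped ENNReal

noncomputable section

namespace IB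

/-- Change of variables for finite-valued random variables. -/
lemma sum_real_preimage_comp {Ω α β : Type*} [MeasurableSpace Ω] [Fintype α] [Fintype β]
    (μ : Measure Ω) [IsFiniteMeasure μ] {A : Ω → α} (hA : ∀ a, MeasurableSet (A ⁻¹' {a}))
    (h : α → β) (φ : β → ℝ) :
    ∑ b, μ.real ((h ∘ A) ⁻¹' {b}) * φ b = ∑ a, μ.real (A ⁻¹' {a}) * φ (h a) := by
  classical
  have key : ∀ b, μ.real ((h ∘ A) ⁻¹' {b}) =
      ∑ a ∈ Finset.univ.filter (fun a => h a = b), μ.real (A ⁻¹' {a}) := by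
    intro b
    rw [sum_measureReal_preimage_singleton _ (fun a _ => hA a)]
    congr 1
    ext ω
    simp
  rw [← Finset.sum_fiberwise Finset.univ h]
  refine Finset.sum_congr rfl fun b _ => ?_
  rw [key, Finset.sum_mul]
  refine Finset.sum_congr rfl fun a ha => ?_
  rw [(Finset.mem_filter.1 ha).2]

lemma measurableSet_pair_preimage {Ω α β : Type*} [MeasurableSpace Ω] {A : Ω → α} {B : Ω → β}
    (hA : ∀ a, MeasurableSet (A ⁻¹' {a})) (hB : ∀ b, MeasurableSet (B ⁻¹' {b})) (z : α × β) :
    MeasurableSet ((fun ω => (A ω, B ω)) ⁻¹' {z}) := by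
  have : (fun ω => (A ω, B ω)) ⁻¹' {z} = A ⁻¹' {z.1} ∩ B ⁻¹' {z.2} := by
    ext ω; simp [Prod.ext_iff]
  rw [this]
  exact (hA _).inter (hB _)

lemma real_pair_le_fst {Ω α β : Type*} [MeasurableSpace Ω] (μ : Measure Ω) [IsFiniteMeasure μ]
    (A : Ω → α) (B : Ω → β) (z : α × β) :
    μ.real ((fun ω => (A ω, B ω)) ⁻¹' {z}) ≤ μ.real (A ⁻¹' {z.1}) :=
  measureReal_mono fun ω hω => by
    have : (A ω, B ω) = z := hω
    simp [← this]

lemma real_pair_le_snd {Ω α β : Type*} [MeasurableSpace Ω] (μ : Measure Ω) [IsFiniteMeasure μ]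
    (A : Ω → α) (B : Ω → β) (z : α × β) :
    μ.real ((fun ω => (A ω, B ω)) ⁻¹' {z}) ≤ μ.real (B ⁻¹' {z.2}) :=
  measureReal_mono fun ω hω => by
    have : (A ω, B ω) = z := hω
    simp [← this]

lemma sum_real_preimage_pair_fst {Ω α β : Type*} [MeasurableSpace Ω] [Fintype α] [Fintype β]
    (μ : Measure Ω) [IsFiniteMeasure μ] {A : Ω → α} {B : Ω → β}
    (hA : ∀ a, MeasurableSet (A ⁻¹' {a})) (hB : ∀ b, MeasurableSet (B ⁻¹' {b})) (b : β) :
    ∑ a, μ.real ((fun ω => (A ω, B ω)) ⁻¹' {(a, b)}) = μ.real (B ⁻¹' {b}) := by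
  classical
  have h := sum_real_preimage_comp μ (measurableSet_pair_preimage hA hB) Prod.snd
    (fun b' => if b' = b then (1 : ℝ) else 0)
  simp only [mul_ite, mul_one, mul_zero, Finset.sum_ite_eq', Finset.mem_univ, if_true,
    Fintype.sum_prod_type] at h
  exact h.symm

lemma sum_real_preimage_pair_snd {Ω α β : Type*} [MeasurableSpace Ω] [Fintype α] [Fintype β]
    (μ : Measure Ω) [IsFiniteMeasure μ] {A : Ω → α} {B : Ω → β}
    (hA : ∀ a, MeasurableSet (A ⁻¹' {a})) (hB : ∀ b, MeasurableSet (B ⁻¹' {b})) (a : α) :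
    ∑ b, μ.real ((fun ω => (A ω, B ω)) ⁻¹' {(a, b)}) = μ.real (A ⁻¹' {a}) := by
  classical
  have h := sum_real_preimage_comp μ (measurableSet_pair_preimage hA hB) Prod.fst
    (fun a' => if a' = a then (1 : ℝ) else 0)
  simp only [mul_ite, mul_one, mul_zero, Finset.sum_ite_eq', Finset.mem_univ, if_true,
    Fintype.sum_prod_type_right] at h
  exact h.symm

lemma sum_real_preimage_singleton_eq_one {Ω α : Type*} [MeasurableSpace Ω] [Fintype α]
    (μ : Measure Ω) [IsProbabilityMeasure μ] {A : Ω → α} (hA : ∀ a, MeasurableSet (A ⁻¹' {a})) :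
    ∑ a, μ.real (A ⁻¹' {a}) = 1 := by
  rw [sum_measureReal_preimage_singleton _ (fun a _ => hA a)]
  simp

lemma miFin_eq_sum_log {Ω α β : Type*} [MeasurableSpace Ω] [Fintype α] [Fintype β]
    (μ : Measure Ω) [IsProbabilityMeasure μ] {A : Ω → α} {B : Ω → β}
    (hA : ∀ a, MeasurableSet (A ⁻¹' {a})) (hB : ∀ b, MeasurableSet (B ⁻¹' {b})) :
    miFin μ A B = ∑ z : α × β, μ.real ((fun ω => (A ω, B ω)) ⁻¹' {z}) *
      log (μ.real ((fun ω => (A ω, B ω)) ⁻¹' {z}) /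
        (μ.real (A ⁻¹' {z.1}) * μ.real (B ⁻¹' {z.2}))) := by
  have hAB := measurableSet_pair_preimage hA hB
  have h1 := sum_real_preimage_comp μ hAB Prod.fst (fun a => -log (μ.real (A ⁻¹' {a})))
  have h2 := sum_real_preimage_comp μ hAB Prod.snd (fun b => -log (μ.real (B ⁻¹' {b})))
  have e1 : ent μ A = ∑ a, μ.real (A ⁻¹' {a}) * -log (μ.real (A ⁻¹' {a})) :=
    Finset.sum_congr rfl fun a _ => by simp only [negMulLog, Measure.real]; ring
  have e2 : ent μ B = ∑ b, μ.real (B ⁻¹' {b}) * -log (μ.real (B ⁻¹' {b})) :=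
    Finset.sum_congr rfl fun a _ => by simp only [negMulLog, Measure.real]; ring
  unfold miFin
  rw [e1, e2]
  erw [h1, h2]
  rw [ent, ← Finset.sum_add_distrib, ← Finset.sum_sub_distrib]
  refine Finset.sum_congr rfl fun z _ => ?_
  change _ - negMulLog (μ.real _) = _
  have hz : 0 ≤ μ.real ((fun ω => (A ω, B ω)) ⁻¹' {z}) := measureReal_nonneg
  rcases hz.eq_or_lt with h0 | h0
  · rw [← h0]; simp
  · have ha := h0.trans_le (real_pair_le_fst μ A B z)
    have hb := h0.trans_le (real_pair_le_snd μ A B z)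
    rw [log_div h0.ne' (by positivity), log_mul ha.ne' hb.ne', negMulLog]
    ring

/-- A variational lower bound on mutual information. -/
lemma sum_log_le_miFin {Ω α β : Type*} [MeasurableSpace Ω] [Fintype α] [Fintype β]
    (μ : Measure Ω) [IsProbabilityMeasure μ] {A : Ω → α} {B : Ω → β}
    (hA : ∀ a, MeasurableSet (A ⁻¹' {a})) (hB : ∀ b, MeasurableSet (B ⁻¹' {b}))
    (r : α → β → ℝ) (hr : ∀ a b, 0 ≤ r a b)
    (hr' : ∀ z : α × β, 0 < μ.real ((fun ω => (A ω, B ω)) ⁻¹' {z}) → 0 < r z.1 z.2)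
    (hsum : ∀ b, ∑ a, μ.real (A ⁻¹' {a}) * r a b ≤ 1) :
    ∑ z : α × β, μ.real ((fun ω => (A ω, B ω)) ⁻¹' {z}) * log (r z.1 z.2) ≤ miFin μ A B := by
  have hAB := measurableSet_pair_preimage hA hB
  rw [miFin_eq_sum_log μ hA hB]
  have key : ∀ z : α × β, μ.real ((fun ω => (A ω, B ω)) ⁻¹' {z}) * log (r z.1 z.2) ≤
      μ.real ((fun ω => (A ω, B ω)) ⁻¹' {z}) *
      log (μ.real ((fun ω => (A ω, B ω)) ⁻¹' {z}) /
        (μ.real (A ⁻¹' {z.1}) * μ.real (B ⁻¹' {z.2}))) +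
      (μ.real (B ⁻¹' {z.2}) * (μ.real (A ⁻¹' {z.1}) * r z.1 z.2) -
        μ.real ((fun ω => (A ω, B ω)) ⁻¹' {z})) := by
    intro z
    have hz : 0 ≤ μ.real ((fun ω => (A ω, B ω)) ⁻¹' {z}) := measureReal_nonneg
    rcases hz.eq_or_lt with h0 | h0
    · rw [← h0]
      have := hr z.1 z.2
      simp only [zero_mul, zero_add, sub_zero]
      positivity
    · have ha := h0.trans_le (real_pair_le_fst μ A B z)
      have hb := h0.trans_le (real_pair_le_snd μ A B z)
      have hrz := hr' z h0
      set p := μ.real ((fun ω => (A ω, B ω)) ⁻¹' {z})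
      set a := μ.real (A ⁻¹' {z.1})
      set b := μ.real (B ⁻¹' {z.2})
      have h := log_le_sub_one_of_pos (x := r z.1 z.2 * (a * b) / p) (by positivity)
      rw [log_div (by positivity) h0.ne', log_mul hrz.ne' (by positivity)] at h
      rw [log_div h0.ne' (by positivity)]
      have h' := mul_le_mul_of_nonneg_left h h0.le
      have : p * (r z.1 z.2 * (a * b) / p - 1) = b * (a * r z.1 z.2) - p := by
        field_simp
      rw [this] at h'
      linarith
  have hs := Finset.sum_le_sum fun z (_ : z ∈ Finset.univ) => key z
  rw [Finset.sum_add_distrib, Finset.sum_sub_distrib,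
    sum_real_preimage_singleton_eq_one μ hAB, Fintype.sum_prod_type_right
      (f := fun z : α × β => μ.real (B ⁻¹' {z.2}) * (μ.real (A ⁻¹' {z.1}) * r z.1 z.2))] at hs
  have hb : ∑ b, ∑ a, μ.real (B ⁻¹' {b}) * (μ.real (A ⁻¹' {a}) * r a b) ≤ 1 := by
    calc _ ≤ ∑ b, μ.real (B ⁻¹' {b}) * 1 := Finset.sum_le_sum fun b _ => by
          rw [← Finset.mul_sum]
          exact mul_le_mul_of_nonneg_left (hsum b) measureReal_nonneg
      _ = 1 := by simpa using sum_real_preimage_singleton_eq_one μ hB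
  linarith

lemma miFin_nonneg {Ω α β : Type*} [MeasurableSpace Ω] [Fintype α] [Fintype β]
    (μ : Measure Ω) [IsProbabilityMeasure μ] {A : Ω → α} {B : Ω → β}
    (hA : ∀ a, MeasurableSet (A ⁻¹' {a})) (hB : ∀ b, MeasurableSet (B ⁻¹' {b})) :
    0 ≤ miFin μ A B := by
  simpa using sum_log_le_miFin μ hA hB (fun _ _ => 1) (by simp) (by simp)
    (by simp [sum_real_preimage_singleton_eq_one μ hA])

/-- The data-processing inequality. -/
lemma miFin_comp_le {Ω α β γ δ : Type*} [MeasurableSpace Ω] [Fintype α] [Fintype β] [Fintype γ]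
    [Fintype δ] (μ : Measure Ω) [IsProbabilityMeasure μ] {A : Ω → α} {B : Ω → β}
    (hA : ∀ a, MeasurableSet (A ⁻¹' {a})) (hB : ∀ b, MeasurableSet (B ⁻¹' {b}))
    (f : α → γ) (g : β → δ) :
    miFin μ (f ∘ A) (g ∘ B) ≤ miFin μ A B := by
  have hAB := measurableSet_pair_preimage hA hB
  have hfA : ∀ c, MeasurableSet ((f ∘ A) ⁻¹' {c}) := fun c => by
    rw [Set.preimage_comp, ← Set.biUnion_preimage_singleton]
    exact MeasurableSet.biUnion (Set.to_countable _) fun a _ => hA a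
  have hgB : ∀ c, MeasurableSet ((g ∘ B) ⁻¹' {c}) := fun c => by
    rw [Set.preimage_comp, ← Set.biUnion_preimage_singleton]
    exact MeasurableSet.biUnion (Set.to_countable _) fun a _ => hB a
  set P : γ × δ → ℝ := fun z => μ.real ((fun ω => ((f ∘ A) ω, (g ∘ B) ω)) ⁻¹' {z}) with hP
  set r : γ → δ → ℝ := fun s t =>
    P (s, t) / (μ.real ((f ∘ A) ⁻¹' {s}) * μ.real ((g ∘ B) ⁻¹' {t})) with hr
  have hsum := sum_real_preimage_comp μ hAB (Prod.map f g) (fun z => log (r z.1 z.2))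
  rw [miFin_eq_sum_log μ hfA hgB]
  refine hsum.le.trans ?_
  refine sum_log_le_miFin μ hA hB (fun a b => r (f a) (g b)) (fun a b => by positivity) ?_ ?_
  · intro z hz
    have h1 : 0 < P (f z.1, g z.2) := hz.trans_le <| measureReal_mono fun ω hω => by
      have : (A ω, B ω) = z := hω
      simp [← this]
    have h2 := h1.trans_le (real_pair_le_fst μ (f ∘ A) (g ∘ B) _)
    have h3 := h1.trans_le (real_pair_le_snd μ (f ∘ A) (g ∘ B) _)
    exact div_pos h1 (mul_pos h2 h3)
  · intro b
    have h1 := sum_real_preimage_comp μ hA f (fun s => r s (g b))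
    rw [← h1]
    calc _ ≤ ∑ s, P (s, g b) / μ.real ((g ∘ B) ⁻¹' {g b}) := Finset.sum_le_sum fun s _ => by
          have h0 : 0 ≤ μ.real ((f ∘ A) ⁻¹' {s}) := measureReal_nonneg
          rcases h0.eq_or_lt with h | h
          · rw [← h, zero_mul]; positivity
          · simp only [hr]
            rw [mul_div_assoc', mul_div_mul_left _ _ h.ne']
      _ ≤ 1 := by
          rw [← Finset.sum_div, sum_real_preimage_pair_fst μ hfA hgB]
          exact div_self_le_one _

open scoped Classical in
/-- An exponential large-deviation bound for sums of a function with negative mean. -/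
lemma exists_exponential_tail_bound {Z : Type*} [Fintype Z] (p : Z → ℝ) (hp : ∀ z, 0 ≤ p z)
    (hsum : ∑ z, p z = 1) (h : Z → ℝ) (hneg : ∑ z, p z * h z < 0) :
    ∃ ρ : ℝ, 0 ≤ ρ ∧ ρ < 1 ∧ ∀ n : ℕ,
      ∑ z : Fin n → Z, (∏ i, p (z i)) * (if 0 ≤ ∑ i, h (z i) then 1 else 0) ≤ ρ ^ n := by
  set K : ℝ := 1 + ∑ z, |h z| with hK
  have hK1 : 1 ≤ K := le_add_of_nonneg_right (Finset.sum_nonneg fun _ _ => abs_nonneg _)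
  have hhK : ∀ z, |h z| ≤ K := fun z =>
    (Finset.single_le_sum (f := fun z => |h z|) (fun _ _ => abs_nonneg _)
      (Finset.mem_univ z)).trans (by linarith)
  set d : ℝ := -∑ z, p z * h z with hd
  have hd0 : 0 < d := by linarith
  have hdK : d ≤ K := by
    rw [hd, ← Finset.sum_neg_distrib]
    calc _ ≤ ∑ z, p z * K := Finset.sum_le_sum fun z _ => by
          have := mul_le_mul_of_nonneg_left ((neg_le_abs (h z)).trans (hhK z)) (hp z)
          linarith
      _ = K := by rw [← Finset.sum_mul, hsum, one_mul]
  set t : ℝ := d / (2 * K ^ 2) with ht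
  have ht0 : 0 < t := by positivity
  have htK : t * K ≤ 1 := by
    rw [ht, div_mul_eq_mul_div, div_le_one (by positivity)]
    nlinarith
  refine ⟨∑ z, p z * exp (t * h z), Finset.sum_nonneg fun z _ => mul_nonneg (hp z) (exp_pos _).le,
    ?_, ?_⟩
  · have hb : ∀ z, p z * exp (t * h z) ≤ p z * 1 + t * (p z * h z) + p z * (t * K) ^ 2 := by
      intro z
      have h1 : |t * h z| ≤ t * K := by
        rw [abs_mul, abs_of_pos ht0]
        exact mul_le_mul_of_nonneg_left (hhK z) ht0.le
      have h2 := (abs_le.1 (abs_exp_sub_one_sub_id_le (h1.trans htK))).2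
      have h3 : (t * h z) ^ 2 ≤ (t * K) ^ 2 := sq_le_sq' (by linarith [(abs_le.1 h1).1])
        (abs_le.1 h1).2
      have := mul_le_mul_of_nonneg_left
        (show exp (t * h z) ≤ 1 + t * h z + (t * K) ^ 2 by linarith) (hp z)
      linarith
    have hs := Finset.sum_le_sum fun z (_ : z ∈ Finset.univ) => hb z
    rw [Finset.sum_add_distrib, Finset.sum_add_distrib, ← Finset.sum_mul, ← Finset.mul_sum,
      ← Finset.sum_mul, hsum] at hs
    have e1 : ∑ z, p z * h z = -d := by rw [hd, neg_neg]
    rw [e1] at hs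
    have e2 : (t * K) ^ 2 = t * d / 2 := by
      rw [ht]; field_simp
    have : 0 < t * d := by positivity
    linarith
  · intro n
    rw [Fintype.sum_pow]
    refine Finset.sum_le_sum fun z _ => ?_
    rw [Finset.prod_mul_distrib, ← exp_sum, ← Finset.mul_sum]
    refine mul_le_mul_of_nonneg_left ?_ (Finset.prod_nonneg fun i _ => hp _)
    split_ifs with h0
    · exact one_le_exp (by positivity)
    · positivity

open scoped Classical in
/-- Random coding: some codebook of size `M` leaves at most the expected weight uncovered. -/
lemma exists_codebook_uncovered_le {B C : Type*} [Fintype B] [Fintype C] (q : C → ℝ)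
    (hq : ∀ u, 0 ≤ q u) (hqs : ∑ u, q u = 1) (G : Set (B × C)) (M : ℕ) :
    ∀ v : B → ℝ, (∀ x, 0 ≤ v x) → ∃ c : Fin M → C,
      ∑ x, v x * (if ∀ m, (x, c m) ∉ G then 1 else 0) ≤
        ∑ x, v x * (∑ u, q u * if (x, u) ∉ G then 1 else 0) ^ M := by
  induction M with
  | zero => intro v _; exact ⟨Fin.elim0, by simp⟩
  | succ M ih =>
    intro v hv
    set τ : B → ℝ := fun x => ∑ u, q u * (if (x, u) ∉ G then (1 : ℝ) else 0) with hτ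
    obtain ⟨u, hu⟩ : ∃ u, ∑ x, v x * τ x ^ M * (if (x, u) ∉ G then (1 : ℝ) else 0) ≤
        ∑ x, v x * τ x ^ (M + 1) := by
      by_contra! hcon
      have e : ∑ u, q u * ∑ x, v x * τ x ^ M * (if (x, u) ∉ G then (1 : ℝ) else 0) =
          ∑ x, v x * τ x ^ (M + 1) := by
        simp_rw [Finset.mul_sum]
        rw [Finset.sum_comm]
        refine Finset.sum_congr rfl fun x _ => ?_
        rw [pow_succ, ← mul_assoc]
        conv_rhs => rw [hτ]
        simp only [Finset.mul_sum]
        refine Finset.sum_congr rfl fun u _ => ?_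
        ring
      obtain ⟨u₀, hu₀⟩ : ∃ u, 0 < q u := by
        by_contra! h0
        have := Finset.sum_nonpos fun u (_ : u ∈ Finset.univ) => h0 u
        linarith
      have : ∑ u, q u * ∑ x, v x * τ x ^ (M + 1) <
          ∑ u, q u * ∑ x, v x * τ x ^ M * (if (x, u) ∉ G then (1 : ℝ) else 0) :=
        Finset.sum_lt_sum (fun u _ => mul_le_mul_of_nonneg_left (hcon u).le (hq u))
          ⟨u₀, Finset.mem_univ _, mul_lt_mul_of_pos_left (hcon u₀) hu₀⟩
      rw [e, ← Finset.sum_mul, hqs, one_mul] at this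
      exact this.false
    obtain ⟨c, hc⟩ := ih (fun x => v x * (if (x, u) ∉ G then 1 else 0))
      (fun x => mul_nonneg (hv x) (by split_ifs <;> norm_num))
    refine ⟨Fin.cons u c, le_trans (le_of_eq ?_) (hc.trans (le_trans (le_of_eq ?_) hu))⟩
    · refine Finset.sum_congr rfl fun x _ => ?_
      simp only [Fin.forall_fin_succ, Fin.cons_zero, Fin.cons_succ]
      by_cases h1 : (x, u) ∈ G <;> simp [h1]
    · refine Finset.sum_congr rfl fun x _ => ?_
      ring

lemma exp_neg_mul_le {K s : ℝ} (h0 : 0 ≤ s) (h1 : s ≤ 1) :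
    exp (-(K * s)) ≤ 1 - s + exp (-K) := by
  have h := convexOn_exp.2 (Set.mem_univ 0) (Set.mem_univ (-K)) (sub_nonneg.2 h1) h0 (by ring)
  simp only [smul_eq_mul, mul_zero, zero_add, exp_zero, mul_one] at h
  have h2 : s * exp (-K) ≤ exp (-K) := mul_le_of_le_one_left (exp_pos _).le h1
  have h3 : -(K * s) = s * -K := by ring
  rw [h3]
  linarith

open scoped Classical in
/-- One-shot covering lemma. -/
lemma exists_codebook_covering {B C : Type*} [Fintype B] [Fintype C] (P : B × C → ℝ)
    (v : B → ℝ) (q : C → ℝ) (hP : ∀ z, 0 ≤ P z) (hPs : ∑ z, P z = 1)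
    (hv : ∀ x, ∑ u, P (x, u) = v x) (hq : ∀ u, 0 ≤ q u) (hqs : ∑ u, q u = 1)
    (G : Set (B × C)) {T : ℝ} (hT : 0 < T) (hG : ∀ z ∈ G, P z ≤ T * (v z.1 * q z.2)) (M : ℕ) :
    ∃ c : Fin M → C, ∑ x, v x * (if ∀ m, (x, c m) ∉ G then 1 else 0) ≤
      ∑ z, P z * (if z ∉ G then 1 else 0) + exp (-(M / T)) := by
  have hv0 : ∀ x, 0 ≤ v x := fun x => hv x ▸ Finset.sum_nonneg fun u _ => hP _
  obtain ⟨c, hc⟩ := exists_codebook_uncovered_le q hq hqs G M v hv0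
  refine ⟨c, hc.trans ?_⟩
  have hvs : ∑ x, v x = 1 := by rw [← hPs, Fintype.sum_prod_type]; simp [hv]
  have key : ∀ x, v x * (∑ u, q u * if (x, u) ∉ G then (1 : ℝ) else 0) ^ M ≤
      ∑ u, P (x, u) * (if (x, u) ∉ G then 1 else 0) + v x * exp (-(M / T)) := by
    intro x
    have hR : 0 ≤ ∑ u, P (x, u) * (if (x, u) ∉ G then (1 : ℝ) else 0) :=
      Finset.sum_nonneg fun u _ => mul_nonneg (hP _) (by split_ifs <;> norm_num)
    rcases (hv0 x).eq_or_lt with h0 | h0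
    · rw [← h0]; simpa using hR
    set s : ℝ := (∑ u, P (x, u) * (if (x, u) ∈ G then (1 : ℝ) else 0)) / v x with hs
    have hcompl : ∑ u, P (x, u) * (if (x, u) ∉ G then (1 : ℝ) else 0) =
        v x - ∑ u, P (x, u) * (if (x, u) ∈ G then (1 : ℝ) else 0) := by
      rw [← hv x, ← Finset.sum_sub_distrib]
      refine Finset.sum_congr rfl fun u _ => ?_
      by_cases h1 : (x, u) ∈ G <;> simp [h1]
    have hcompl' : ∑ u, q u * (if (x, u) ∉ G then (1 : ℝ) else 0) =
        1 - ∑ u, q u * (if (x, u) ∈ G then (1 : ℝ) else 0) := by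
      rw [eq_sub_iff_add_eq, ← Finset.sum_add_distrib]
      refine (Finset.sum_congr rfl fun u _ => ?_).trans hqs
      by_cases h1 : (x, u) ∈ G <;> simp [h1]
    have hs0 : 0 ≤ s := div_nonneg (Finset.sum_nonneg fun u _ =>
      mul_nonneg (hP _) (by split_ifs <;> norm_num)) h0.le
    have hvs : v x * s = ∑ u, P (x, u) * (if (x, u) ∈ G then (1 : ℝ) else 0) := by
      rw [hs]; field_simp
    have hs1 : s ≤ 1 := by
      rw [hs, div_le_one h0]; linarith
    have hsT : s / T ≤ ∑ u, q u * (if (x, u) ∈ G then (1 : ℝ) else 0) := by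
      rw [div_le_iff₀ hT, hs, div_le_iff₀ h0, Finset.sum_mul, Finset.sum_mul]
      refine Finset.sum_le_sum fun u _ => ?_
      by_cases h1 : (x, u) ∈ G
      · have := hG _ h1
        simp only [h1, if_true, mul_one]
        linarith
      · simp [h1]
    have hpow : (∑ u, q u * if (x, u) ∉ G then (1 : ℝ) else 0) ^ M ≤ exp (-(M / T * s)) := by
      have hle : ∑ u, q u * (if (x, u) ∉ G then (1 : ℝ) else 0) ≤ exp (-(s / T)) := by
        rw [hcompl']
        have := add_one_le_exp (-(s / T))
        linarith
      calc _ ≤ exp (-(s / T)) ^ M := pow_le_pow_left₀ (Finset.sum_nonneg fun u _ =>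
            mul_nonneg (hq _) (by split_ifs <;> norm_num)) hle M
        _ = _ := by rw [← exp_nat_mul]; congr 1; ring
    have := mul_le_mul_of_nonneg_left (hpow.trans (exp_neg_mul_le hs0 hs1)) h0.le
    rw [hcompl, ← hvs]
    linarith
  calc _ ≤ _ := Finset.sum_le_sum fun x _ => key x
    _ = _ := by
      rw [Finset.sum_add_distrib, ← Finset.sum_mul, hvs, one_mul, Fintype.sum_prod_type]

open scoped Classical in
/-- Achievability half of the rate-distortion theorem, for a finite source and reconstruction
alphabet and a score function `g`. -/
lemma exists_rate_distortion_code {B C : Type*} [Fintype B] [Fintype C] (P : B × C → ℝ)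
    (v : B → ℝ) (q : C → ℝ) (hP : ∀ z, 0 ≤ P z) (hPs : ∑ z, P z = 1)
    (hv : ∀ x, ∑ u, P (x, u) = v x) (hq : ∀ u, ∑ x, P (x, u) = q u)
    (hI : 0 ≤ ∑ z, P z * log (P z / (v z.1 * q z.2))) (g : B × C → ℝ) {ε : ℝ} (hε : 0 < ε) :
    ∃ n : ℕ, 0 < n ∧ ∃ (m : ℕ) (c : Fin (m + 1) → Fin n → C) (f : (Fin n → B) → Fin (m + 1)),
      log (m + 1) ≤ n * (∑ z, P z * log (P z / (v z.1 * q z.2)) + ε) ∧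
      n * (∑ z, P z * g z - ε) ≤ ∑ x : Fin n → B, (∏ i, v (x i)) * ∑ i, g (x i, c (f x) i) := by
  set I := ∑ z, P z * log (P z / (v z.1 * q z.2)) with hId
  set E := ∑ z, P z * g z with hE
  have hv0 : ∀ x, 0 ≤ v x := fun x => hv x ▸ Finset.sum_nonneg fun u _ => hP _
  have hq0 : ∀ u, 0 ≤ q u := fun u => hq u ▸ Finset.sum_nonneg fun x _ => hP _
  have hvs : ∑ x, v x = 1 := by rw [← hPs, Fintype.sum_prod_type]; simp [hv]
  have hqs : ∑ u, q u = 1 := by rw [← hPs, Fintype.sum_prod_type_right]; simp [hq]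
  set δ := ε / 3 with hδ
  have hδ0 : 0 < δ := by positivity
  set L : ℝ := ∑ z, |g z| with hL
  have hgL : ∀ z, |g z| ≤ L := fun z =>
    Finset.single_le_sum (f := fun z => |g z|) (fun _ _ => abs_nonneg _) (Finset.mem_univ z)
  have hL0 : 0 ≤ L := Finset.sum_nonneg fun _ _ => abs_nonneg _
  have hEL : E ≤ L := by
    calc E ≤ ∑ z, P z * L := Finset.sum_le_sum fun z _ =>
          mul_le_mul_of_nonneg_left ((le_abs_self _).trans (hgL z)) (hP z)
      _ = L := by rw [← Finset.sum_mul, hPs, one_mul]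
  set h₁ : B × C → ℝ := fun z => log (P z / (v z.1 * q z.2)) - (I + δ) with hh₁
  set h₂ : B × C → ℝ := fun z => (E - δ) - g z with hh₂
  obtain ⟨ρ₁, hρ₁0, hρ₁1, hρ₁⟩ := exists_exponential_tail_bound P hP hPs h₁ (by
    simp only [hh₁, mul_sub, Finset.sum_sub_distrib, ← Finset.sum_mul, hPs]
    rw [← hId]; linarith)
  obtain ⟨ρ₂, hρ₂0, hρ₂1, hρ₂⟩ := exists_exponential_tail_bound P hP hPs h₂ (by
    simp only [hh₂, mul_sub, Finset.sum_sub_distrib, ← Finset.sum_mul, hPs]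
    rw [← hE]; linarith)
  obtain ⟨n, hn0, hn2, hnf⟩ : ∃ n : ℕ, 0 < n ∧ log 2 ≤ n * δ ∧
      2 * L * (ρ₁ ^ n + ρ₂ ^ n + exp (-δ) ^ n) < δ := by
    have hlim : Filter.Tendsto (fun n : ℕ => 2 * L * (ρ₁ ^ n + ρ₂ ^ n + exp (-δ) ^ n))
        Filter.atTop (nhds (2 * L * (0 + 0 + 0))) :=
      (((tendsto_pow_atTop_nhds_zero_of_lt_one hρ₁0 hρ₁1).add
        (tendsto_pow_atTop_nhds_zero_of_lt_one hρ₂0 hρ₂1)).add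
        (tendsto_pow_atTop_nhds_zero_of_lt_one (exp_pos _).le
          (exp_lt_one_iff.2 (neg_lt_zero.2 hδ0)))).const_mul _
    have h1 := hlim.eventually_lt_const (u := δ) (by simpa using hδ0)
    have h2 := (tendsto_natCast_atTop_atTop (R := ℝ)).atTop_mul_const hδ0
    obtain ⟨n, hn1, hn2, hn3⟩ := (h1.and ((h2.eventually_ge_atTop (log 2)).and
      (Filter.eventually_gt_atTop 0))).exists
    exact ⟨n, hn3, hn2, hn1⟩
  set m : ℕ := ⌊exp (n * (I + 2 * δ))⌋₊ with hm
  set Pn : (Fin n → B) × (Fin n → C) → ℝ := fun z => ∏ i, P (z.1 i, z.2 i) with hPn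
  obtain ⟨G, hG⟩ : ∃ G : Set ((Fin n → B) × (Fin n → C)), ∀ z, z ∈ G ↔
      ∑ i, h₁ (z.1 i, z.2 i) < 0 ∧ ∑ i, h₂ (z.1 i, z.2 i) < 0 ∧ 0 < Pn z :=
    ⟨{z | ∑ i, h₁ (z.1 i, z.2 i) < 0 ∧ ∑ i, h₂ (z.1 i, z.2 i) < 0 ∧ 0 < Pn z}, fun _ => Iff.rfl⟩
  have hPn0 : ∀ z, 0 ≤ Pn z := fun z => Finset.prod_nonneg fun i _ => hP _
  have hsumz : ∀ F : (Fin n → B × C) → ℝ,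
      ∑ z : (Fin n → B) × (Fin n → C), F (fun i => (z.1 i, z.2 i)) = ∑ w, F w := fun F =>
    (Equiv.sum_comp (Equiv.arrowProdEquivProdArrow (Fin n) (fun _ => B) (fun _ => C)).symm F)
  have hGT : ∀ z ∈ G, Pn z ≤
      exp (n * (I + δ)) * ((∏ i, v (z.1 i)) * ∏ i, q (z.2 i)) := by
    intro z hz
    obtain ⟨hz1, -, hz3⟩ := (hG z).1 hz
    have hpos : ∀ i, 0 < P (z.1 i, z.2 i) := fun i =>
      (hP _).lt_of_ne' fun h => hz3.ne' (Finset.prod_eq_zero (Finset.mem_univ i) h)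
    have hvp : ∀ i, 0 < v (z.1 i) := fun i => (hpos i).trans_le <| hv (z.1 i) ▸
      Finset.single_le_sum (f := fun u => P (z.1 i, u)) (fun _ _ => hP _) (Finset.mem_univ _)
    have hqp : ∀ i, 0 < q (z.2 i) := fun i => (hpos i).trans_le <| hq (z.2 i) ▸
      Finset.single_le_sum (f := fun x => P (x, z.2 i)) (fun _ _ => hP _) (Finset.mem_univ _)
    have e : Pn z = exp (∑ i, log (P (z.1 i, z.2 i) / (v (z.1 i) * q (z.2 i)))) *
        ((∏ i, v (z.1 i)) * ∏ i, q (z.2 i)) := by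
      rw [exp_sum, ← Finset.prod_mul_distrib, ← Finset.prod_mul_distrib]
      refine Finset.prod_congr rfl fun i _ => ?_
      have h1 := hpos i
      have h2 := hvp i
      have h3 := hqp i
      rw [exp_log (by positivity)]
      field_simp
    rw [e]
    refine mul_le_mul_of_nonneg_right (exp_le_exp.2 ?_) (mul_nonneg
      (Finset.prod_nonneg fun i _ => hv0 _) (Finset.prod_nonneg fun i _ => hq0 _))
    simp only [hh₁, Finset.sum_sub_distrib, Finset.sum_const, Finset.card_univ, Fintype.card_fin,
      nsmul_eq_mul] at hz1
    linarith
  obtain ⟨c, hc⟩ := exists_codebook_covering Pn (fun x => ∏ i, v (x i)) (fun u => ∏ i, q (u i))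
    hPn0 (by rw [hsumz (fun w => ∏ i, P (w i)), ← Fintype.sum_pow, hPs, one_pow])
    (fun x => by
      simp only [hPn, ← hv]
      rw [Finset.prod_univ_sum, Fintype.piFinset_univ])
    (fun u => Finset.prod_nonneg fun i _ => hq0 _)
    (by rw [← Fintype.sum_pow, hqs, one_pow]) G (exp_pos _) hGT (m + 1)
  have hfail : ∑ x : Fin n → B, (∏ i, v (x i)) * (if ∀ k, (x, c k) ∉ G then (1 : ℝ) else 0) ≤
      ρ₁ ^ n + ρ₂ ^ n + exp (-δ) ^ n := by
    refine hc.trans (add_le_add ?_ ?_)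
    · refine le_trans ?_ (add_le_add (hρ₁ n) (hρ₂ n))
      rw [← hsumz (fun w => (∏ i, P (w i)) * _), ← hsumz (fun w => (∏ i, P (w i)) * _),
        ← Finset.sum_add_distrib]
      refine Finset.sum_le_sum fun z _ => ?_
      rw [← mul_add]
      rcases (hPn0 z).eq_or_lt with h0 | h0
      · rw [← h0, zero_mul]
        change _ ≤ Pn z * _
        rw [← h0, zero_mul]
      · refine mul_le_mul_of_nonneg_left ?_ h0.le
        by_cases hz : z ∈ G
        · simp only [hz, not_true, if_false]
          positivity
        · simp only [hz, not_false_eq_true, if_true]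
          by_cases ha : 0 ≤ ∑ i, h₁ (z.1 i, z.2 i)
          · simp only [ha, if_true]
            exact le_add_of_nonneg_right (by positivity)
          · have hb : 0 ≤ ∑ i, h₂ (z.1 i, z.2 i) := by
              by_contra hb
              exact hz <| (hG z).2 ⟨not_le.1 ha, not_le.1 hb, h0⟩
            simp only [hb, if_true]
            exact le_add_of_nonneg_left (by positivity)
    · rw [← exp_nat_mul]
      refine exp_le_exp.2 ?_
      have h1 : exp (n * (I + 2 * δ)) ≤ ((m + 1 : ℕ) : ℝ) := by
        push_cast; exact (Nat.lt_floor_add_one _).le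
      have h2 : n * δ ≤ ((m + 1 : ℕ) : ℝ) / exp (n * (I + δ)) := by
        rw [le_div_iff₀ (exp_pos _)]
        refine le_trans ?_ h1
        have e : (n : ℝ) * (I + 2 * δ) = n * δ + n * (I + δ) := by ring
        rw [e, exp_add]
        refine mul_le_mul_of_nonneg_right ?_ (exp_pos _).le
        have := add_one_le_exp ((n : ℝ) * δ)
        linarith
      linarith
  refine ⟨n, hn0, m, c, fun x => if h : ∃ k, (x, c k) ∈ G then h.choose else 0, ?_, ?_⟩
  · have hone : 1 ≤ exp (n * (I + 2 * δ)) := one_le_exp (by positivity)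
    have h1 : (m : ℝ) + 1 ≤ 2 * exp (n * (I + 2 * δ)) := by
      have := Nat.floor_le (exp_pos (n * (I + 2 * δ))).le
      rw [← hm] at this
      linarith
    have h2 := log_le_log (by positivity) h1
    rw [log_mul two_ne_zero (exp_pos _).ne', log_exp] at h2
    have e : (n : ℝ) * (I + ε) = n * (I + 2 * δ) + n * δ := by rw [hδ]; ring
    rw [e]
    linarith
  · have hx : ∀ x : Fin n → B, n * (E - δ) - n * (2 * L) *
        (if ∀ k, (x, c k) ∉ G then (1 : ℝ) else 0) ≤
        ∑ i, g (x i, c (if h : ∃ k, (x, c k) ∈ G then h.choose else 0) i) := by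
      intro x
      by_cases h : ∃ k, (x, c k) ∈ G
      · have h' : ¬ ∀ k, (x, c k) ∉ G := by push Not; exact h
        rw [if_neg h']
        simp only [h, dite_true]
        have := ((hG _).1 h.choose_spec).2.1
        simp only [hh₂, Finset.sum_sub_distrib, Finset.sum_const, Finset.card_univ,
          Fintype.card_fin, nsmul_eq_mul] at this
        linarith
      · have h' : ∀ k, (x, c k) ∉ G := by push Not at h; exact h
        rw [if_pos h']
        simp only [h, dite_false]
        have : ∑ i : Fin n, -L ≤ ∑ i, g (x i, c 0 i) :=
          Finset.sum_le_sum fun i _ => (abs_le.1 (hgL _)).1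
        simp only [Finset.sum_const, Finset.card_univ, Fintype.card_fin, nsmul_eq_mul] at this
        have hn : (n : ℝ) * (E - δ) ≤ n * L :=
          mul_le_mul_of_nonneg_left (by linarith) (Nat.cast_nonneg n)
        linarith
    have hsum := Finset.sum_le_sum fun x (_ : x ∈ Finset.univ) =>
      mul_le_mul_of_nonneg_left (hx x)
        (Finset.prod_nonneg fun i _ => hv0 (x i) : 0 ≤ ∏ i, v (x i))
    refine le_trans ?_ hsum
    have e : ∑ x : Fin n → B, (∏ i, v (x i)) * (n * (E - δ) - n * (2 * L) *
        (if ∀ k, (x, c k) ∉ G then (1 : ℝ) else 0)) = n * (E - δ) - n * (2 * L *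
        ∑ x : Fin n → B, (∏ i, v (x i)) * (if ∀ k, (x, c k) ∉ G then (1 : ℝ) else 0)) := by
      have h1 : ∑ x : Fin n → B, ∏ i, v (x i) = 1 := by
        rw [← Fintype.sum_pow, hvs, one_pow]
      simp only [mul_sub, Finset.sum_sub_distrib, ← Finset.sum_mul, h1, Finset.mul_sum]
      rw [one_mul, one_mul]
      congr 1
      refine Finset.sum_congr rfl fun x _ => ?_
      ring
    rw [e, ← mul_sub]
    refine mul_le_mul_of_nonneg_left ?_ (Nat.cast_nonneg n)
    have := mul_le_mul_of_nonneg_left hfail (show 0 ≤ 2 * L by positivity)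
    have : ε = 3 * δ := by rw [hδ]; ring
    linarith

lemma sum_real_preimage_singleton_inter {Ω α : Type*} [MeasurableSpace Ω] [Fintype α]
    (μ : Measure Ω) [IsFiniteMeasure μ] {A : Ω → α} (hA : ∀ a, MeasurableSet (A ⁻¹' {a}))
    (E : Set Ω) : ∑ a, μ.real (A ⁻¹' {a} ∩ E) = μ.real E := by
  have h := sum_measureReal_preimage_singleton (μ := μ.restrict E) Finset.univ (fun a _ => hA a)
  simp only [measureReal_restrict_apply (hA _)] at h
  simpa using h

/-- A Markov chain `Y ⊸ X ⊸ U` with finite outer alphabets is approximated by quantizing `X`. -/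
lemma exists_quantizer_of_markov {Ω 𝒴 𝒳 𝒰 : Type*} [MeasurableSpace Ω]
    [MeasurableSpace 𝒴] [MeasurableSingletonClass 𝒴] [MeasurableSpace 𝒳]
    [Fintype 𝒰] [DecidableEq 𝒰] [MeasurableSpace 𝒰] [MeasurableSingletonClass 𝒰]
    (μ : Measure Ω) [IsProbabilityMeasure μ] {Y : Ω → 𝒴} {X : Ω → 𝒳} {U : Ω → 𝒰}
    (hY : Measurable Y) (hX : Measurable X) (hU : Measurable U)
    (hMarkov : Markov μ Y X U) {δ : ℝ} (hδ : 0 < δ) :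
    ∃ (N : ℕ) (Q : 𝒳 → 𝒰 → Fin (N + 1)), Measurable Q ∧ ∀ y u,
      |∑ s, μ.real ((Q ∘ X) ⁻¹' {s} ∩ Y ⁻¹' {y}) * μ.real ((Q ∘ X) ⁻¹' {s} ∩ U ⁻¹' {u}) /
        μ.real ((Q ∘ X) ⁻¹' {s}) - μ.real (Y ⁻¹' {y} ∩ U ⁻¹' {u})| ≤ δ := by
  obtain ⟨N, hN⟩ := exists_nat_gt (2 / δ)
  have hN0 : (0 : ℝ) < N := lt_trans (by positivity) hN
  have hfac : ∀ u, ∃ h : 𝒳 → ℝ, Measurable h ∧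
      μ[ind (U ⁻¹' {u}) | MeasurableSpace.comap X inferInstance] = h ∘ X := fun u =>
    Measurable.exists_eq_measurable_comp stronglyMeasurable_condExp.measurable
  choose h hh hhX using hfac
  set Q : 𝒳 → 𝒰 → Fin (N + 1) := fun x u => Fin.ofNat (N + 1) ⌊N * h u x⌋₊ with hQ
  have hQm : Measurable Q := measurable_pi_lambda _ fun u =>
    (measurable_from_nat (f := Fin.ofNat (N + 1))).comp
      (Nat.measurable_floor.comp ((hh u).const_mul _))
  refine ⟨N, Q, hQm, fun y u => ?_⟩
  have hm : MeasurableSpace.comap X inferInstance ≤ (inferInstance : MeasurableSpace Ω) :=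
    hX.comap_le
  have hD : ∀ s, MeasurableSet[MeasurableSpace.comap X inferInstance] ((Q ∘ X) ⁻¹' {s}) :=
    fun s => ⟨Q ⁻¹' {s}, hQm (measurableSet_singleton s), rfl⟩
  have hyE : MeasurableSet (Y ⁻¹' {y}) := hY (measurableSet_singleton y)
  have huE : MeasurableSet (U ⁻¹' {u}) := hU (measurableSet_singleton u)
  have hind : ∀ E : Set Ω, MeasurableSet E → Integrable (ind E) μ := fun E hE =>
    (integrable_const (1 : ℝ)).indicator hE
  have hset : ∀ E : Set Ω, MeasurableSet E → ∀ s,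
      ∫ ω in (Q ∘ X) ⁻¹' {s}, (μ[ind E | MeasurableSpace.comap X inferInstance]) ω ∂μ =
        μ.real ((Q ∘ X) ⁻¹' {s} ∩ E) := fun E hE s => by
    rw [setIntegral_condExp hm (hind E hE) (hD s)]
    unfold ind
    rw [setIntegral_indicator hE]
    simp
  have hα0 := condExp_nonneg (μ := μ) (m := MeasurableSpace.comap X inferInstance)
    (f := ind (Y ⁻¹' {y}))
    (Filter.Eventually.of_forall fun ω => Set.indicator_nonneg (fun _ _ => zero_le_one) ω)
  have hβ0 := condExp_nonneg (μ := μ) (m := MeasurableSpace.comap X inferInstance)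
    (f := ind (U ⁻¹' {u}))
    (Filter.Eventually.of_forall fun ω => Set.indicator_nonneg (fun _ _ => zero_le_one) ω)
  have hβ1 := condExp_mono (μ := μ) (m := MeasurableSpace.comap X inferInstance)
    (hind _ huE) (integrable_const (1 : ℝ))
    (Filter.Eventually.of_forall fun ω => Set.indicator_le_self' (fun _ _ => zero_le_one) ω)
  rw [condExp_const hm] at hβ1
  have hMk := hMarkov {y} {u} (measurableSet_singleton y) (measurableSet_singleton u)
  have hj := hset _ (hyE.inter huE)
  have ha := hset _ hyE
  have hb := hset _ huE
  have iα := integrable_condExp (μ := μ) (m := MeasurableSpace.comap X inferInstance)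
    (f := ind (Y ⁻¹' {y}))
  have iβ := integrable_condExp (μ := μ) (m := MeasurableSpace.comap X inferInstance)
    (f := ind (U ⁻¹' {u}))
  have iγ := integrable_condExp (μ := μ) (m := MeasurableSpace.comap X inferInstance)
    (f := ind (Y ⁻¹' {y} ∩ U ⁻¹' {u}))
  have hβX := hhX u
  set α := μ[ind (Y ⁻¹' {y}) | MeasurableSpace.comap X inferInstance]
  set β := μ[ind (U ⁻¹' {u}) | MeasurableSpace.comap X inferInstance]
  set γ := μ[ind (Y ⁻¹' {y} ∩ U ⁻¹' {u}) | MeasurableSpace.comap X inferInstance]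
  have hclose : ∀ s, ∀ᵐ ω ∂(μ.restrict ((Q ∘ X) ⁻¹' {s})),
      |β ω - (s u : ℕ) / N| ≤ 1 / N := by
    intro s
    filter_upwards [ae_restrict_mem (hm _ (hD s)), ae_restrict_of_ae hβ0,
      ae_restrict_of_ae hβ1] with ω hω h0 h1
    have h0' : 0 ≤ β ω := h0
    have h1' : β ω ≤ 1 := h1
    have hs : s = Q (X ω) := hω.symm
    have hle : ⌊N * β ω⌋₊ ≤ N := Nat.floor_le_of_le (by nlinarith)
    have hsu : ((s u : Fin (N + 1)) : ℕ) = ⌊N * β ω⌋₊ := by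
      rw [hs, hβX]
      rw [hβX] at hle
      exact Nat.mod_eq_of_lt (Nat.lt_succ_of_le hle)
    rw [hsu]
    have f1 := Nat.floor_le (show 0 ≤ N * β ω by positivity)
    have f2 := Nat.lt_floor_add_one (N * β ω)
    have e : β ω - (⌊N * β ω⌋₊ : ℝ) / N = (N * β ω - ⌊N * β ω⌋₊) / N := by field_simp
    rw [e, abs_div, abs_of_pos hN0]
    refine div_le_div_of_nonneg_right ?_ hN0.le
    rw [abs_le]
    constructor <;> linarith
  have hcell : ∀ s, |μ.real ((Q ∘ X) ⁻¹' {s} ∩ Y ⁻¹' {y}) *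
      μ.real ((Q ∘ X) ⁻¹' {s} ∩ U ⁻¹' {u}) / μ.real ((Q ∘ X) ⁻¹' {s}) -
      μ.real ((Q ∘ X) ⁻¹' {s} ∩ (Y ⁻¹' {y} ∩ U ⁻¹' {u}))| ≤
      2 / N * μ.real ((Q ∘ X) ⁻¹' {s} ∩ Y ⁻¹' {y}) := by
    intro s
    set t : ℝ := (s u : ℕ) / N with ht
    have b1 : |μ.real ((Q ∘ X) ⁻¹' {s} ∩ (Y ⁻¹' {y} ∩ U ⁻¹' {u})) -
        t * μ.real ((Q ∘ X) ⁻¹' {s} ∩ Y ⁻¹' {y})| ≤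
        1 / N * μ.real ((Q ∘ X) ⁻¹' {s} ∩ Y ⁻¹' {y}) := by
      rw [← hj s, ← ha s, ← integral_const_mul, ← integral_const_mul,
        ← integral_sub iγ.integrableOn (iα.integrableOn.const_mul _)]
      rw [← norm_eq_abs]
      refine norm_integral_le_of_norm_le (iα.integrableOn.const_mul _) ?_
      filter_upwards [hclose s, ae_restrict_of_ae hMk, ae_restrict_of_ae hα0] with ω h1 h2 h3
      have h3' : 0 ≤ α ω := h3
      have h2' : γ ω = α ω * β ω := h2
      rw [h2', norm_eq_abs, mul_comm t, ← mul_sub, abs_mul, abs_of_nonneg h3', mul_comm (1 / _)]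
      exact mul_le_mul_of_nonneg_left h1 h3'
    have b2 : |μ.real ((Q ∘ X) ⁻¹' {s} ∩ U ⁻¹' {u}) - t * μ.real ((Q ∘ X) ⁻¹' {s})| ≤
        1 / N * μ.real ((Q ∘ X) ⁻¹' {s}) := by
      have e : ∀ k : ℝ, k * μ.real ((Q ∘ X) ⁻¹' {s}) = ∫ ω in (Q ∘ X) ⁻¹' {s}, k ∂μ :=
        fun k => by simp [mul_comm]
      rw [← hb s, e, e, ← integral_sub iβ.integrableOn (integrable_const _)]
      rw [← norm_eq_abs]
      exact norm_integral_le_of_norm_le (integrable_const _)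
        ((hclose s).mono fun ω h => by rwa [norm_eq_abs])
    have hda : μ.real ((Q ∘ X) ⁻¹' {s} ∩ Y ⁻¹' {y}) ≤ μ.real ((Q ∘ X) ⁻¹' {s}) :=
      measureReal_mono Set.inter_subset_left (measure_ne_top _ _)
    have hdj : μ.real ((Q ∘ X) ⁻¹' {s} ∩ (Y ⁻¹' {y} ∩ U ⁻¹' {u})) ≤
        μ.real ((Q ∘ X) ⁻¹' {s} ∩ Y ⁻¹' {y}) :=
      measureReal_mono (Set.inter_subset_inter_right _ Set.inter_subset_left) (measure_ne_top _ _)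
    have ha0 : 0 ≤ μ.real ((Q ∘ X) ⁻¹' {s} ∩ Y ⁻¹' {y}) := measureReal_nonneg
    have hj0 : 0 ≤ μ.real ((Q ∘ X) ⁻¹' {s} ∩ (Y ⁻¹' {y} ∩ U ⁻¹' {u})) := measureReal_nonneg
    have hd0 : 0 ≤ μ.real ((Q ∘ X) ⁻¹' {s}) := measureReal_nonneg
    generalize μ.real ((Q ∘ X) ⁻¹' {s} ∩ (Y ⁻¹' {y} ∩ U ⁻¹' {u})) = j at *
    generalize μ.real ((Q ∘ X) ⁻¹' {s} ∩ Y ⁻¹' {y}) = a at *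
    generalize μ.real ((Q ∘ X) ⁻¹' {s} ∩ U ⁻¹' {u}) = b at *
    generalize μ.real ((Q ∘ X) ⁻¹' {s}) = d at *
    rcases hd0.eq_or_lt with h0 | h0
    · have h1 : a = 0 := le_antisymm (h0 ▸ hda) ha0
      have h2 : j = 0 := le_antisymm (h1 ▸ hdj) hj0
      simp [h1, h2]
    · have b3 : |a * b / d - t * a| ≤ 1 / N * a := by
        have e : a * b / d - t * a = a / d * (b - t * d) := by field_simp
        rw [e, abs_mul, abs_of_nonneg (by positivity)]
        calc a / d * |b - t * d| ≤ a / d * (1 / N * d) :=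
              mul_le_mul_of_nonneg_left b2 (by positivity)
          _ = 1 / N * a := by field_simp
      have e : a * b / d - j = (a * b / d - t * a) - (j - t * a) := by ring
      rw [e]
      refine (abs_sub _ _).trans ?_
      have : 2 / (N : ℝ) * a = 1 / N * a + 1 / N * a := by ring
      linarith
  have hDm : ∀ s, MeasurableSet ((Q ∘ X) ⁻¹' {s}) := fun s => hm _ (hD s)
  rw [← sum_real_preimage_singleton_inter μ hDm (Y ⁻¹' {y} ∩ U ⁻¹' {u}),
    ← Finset.sum_sub_distrib]
  refine (Finset.abs_sum_le_sum_abs _ _).trans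
    ((Finset.sum_le_sum fun s _ => hcell s).trans ?_)
  rw [← Finset.mul_sum, sum_real_preimage_singleton_inter μ hDm]
  have h1 : μ.real (Y ⁻¹' {y}) ≤ 1 := measureReal_le_one
  have h2 : 2 / (N : ℝ) ≤ δ := by
    rw [div_lt_iff₀ hδ] at hN
    rw [div_le_iff₀ hN0]; linarith
  calc _ ≤ 2 / (N : ℝ) * 1 := mul_le_mul_of_nonneg_left h1 (by positivity)
    _ ≤ δ := by linarith

lemma miFin_le_miGen {Ω α β S T : Type*} [MeasurableSpace Ω] [MeasurableSpace α]
    [MeasurableSpace β] [Fintype S] [MeasurableSpace S] [MeasurableSingletonClass S] [Nonempty S]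
    [Fintype T] [MeasurableSpace T] [MeasurableSingletonClass T] [Nonempty T]
    (μ : Measure Ω) [IsProbabilityMeasure μ] {A : Ω → α} {B : Ω → β} (hA : Measurable A)
    (hB : Measurable B) {f : α → S} {g : β → T} (hf : Measurable f) (hg : Measurable g) :
    ENNReal.ofReal (miFin μ (f ∘ A) (g ∘ B)) ≤ miGen μ A B := by
  obtain ⟨k, hk⟩ := Nat.exists_eq_succ_of_ne_zero (Fintype.card_ne_zero (α := S))
  obtain ⟨l, hl⟩ := Nat.exists_eq_succ_of_ne_zero (Fintype.card_ne_zero (α := T))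
  let e : S ≃ Fin (k + 1) := Fintype.equivFinOfCardEq hk
  let e' : T ≃ Fin (l + 1) := Fintype.equivFinOfCardEq hl
  have hef : Measurable (e ∘ f) := (Measurable.of_discrete).comp hf
  have heg : Measurable (e' ∘ g) := (Measurable.of_discrete).comp hg
  have h := miFin_comp_le μ (A := (e ∘ f) ∘ A) (B := (e' ∘ g) ∘ B)
    (fun a => (hef.comp hA) (measurableSet_singleton a))
    (fun a => (heg.comp hB) (measurableSet_singleton a)) e.symm e'.symm
  have h1 : e.symm ∘ (e ∘ f) ∘ A = f ∘ A := by ext; simp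
  have h2 : e'.symm ∘ (e' ∘ g) ∘ B = g ∘ B := by ext; simp
  rw [h1, h2] at h
  refine (ENNReal.ofReal_le_ofReal h).trans ?_
  unfold miGen
  exact le_iSup_of_le k <| le_iSup_of_le l <| le_iSup_of_le (e ∘ f) <| le_iSup_of_le (e' ∘ g) <|
    le_iSup_of_le hef <| le_iSup_of_le heg le_rfl

lemma miGen_le_miFin {Ω α β : Type*} [MeasurableSpace Ω] [Fintype α] [Fintype β]
    [MeasurableSpace α] [MeasurableSpace β] (μ : Measure Ω) [IsProbabilityMeasure μ]
    {A : Ω → α} {B : Ω → β}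
    (hA : ∀ a, MeasurableSet (A ⁻¹' {a})) (hB : ∀ b, MeasurableSet (B ⁻¹' {b})) :
    miGen μ A B ≤ ENNReal.ofReal (miFin μ A B) := by
  unfold miGen
  exact iSup_le fun k => iSup_le fun l => iSup_le fun f => iSup_le fun g => iSup_le fun _ =>
    iSup_le fun _ => ENNReal.ofReal_le_ofReal (miFin_comp_le μ hA hB f g)

lemma measurableSet_pi_preimage_singleton {Ω α : Type*} [MeasurableSpace Ω] {A : Ω → α}
    (hA : ∀ a, MeasurableSet (A ⁻¹' {a})) {n : ℕ} (a : Fin n → α) :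
    MeasurableSet ((fun (ω : Fin n → Ω) i => A (ω i)) ⁻¹' {a}) := by
  have : (fun (ω : Fin n → Ω) i => A (ω i)) ⁻¹' {a} = Set.univ.pi fun i => A ⁻¹' {a i} := by
    ext ω; simp [funext_iff]
  rw [this]
  exact MeasurableSet.univ_pi fun i => hA _

lemma pi_real_preimage_singleton {Ω α : Type*} [MeasurableSpace Ω] (μ : Measure Ω)
    [IsProbabilityMeasure μ] (A : Ω → α) {n : ℕ} (a : Fin n → α) :
    (Measure.pi fun _ : Fin n => μ).real ((fun ω i => A (ω i)) ⁻¹' {a}) =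
      ∏ i, μ.real (A ⁻¹' {a i}) := by
  have : (fun (ω : Fin n → Ω) i => A (ω i)) ⁻¹' {a} = Set.univ.pi fun i => A ⁻¹' {a i} := by
    ext ω; simp [funext_iff]
  rw [this, Measure.real, Measure.pi_pi, ENNReal.toReal_prod]
  rfl

lemma sum_prod_mul_sum {A : Type*} [Fintype A] {n : ℕ} (a φ : Fin n → A → ℝ)
    (ha : ∀ i y, 0 ≤ a i y) :
    ∑ y : Fin n → A, (∏ i, a i (y i)) * ∑ i, φ i (y i) =
      (∏ i, ∑ y, a i y) * ∑ i, (∑ y, a i y * φ i y) / ∑ y, a i y := by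
  classical
  by_cases h0 : ∃ i, ∑ y, a i y = 0
  · obtain ⟨i, hi⟩ := h0
    have hi' := (Finset.sum_eq_zero_iff_of_nonneg fun y _ => ha i y).1 hi
    rw [Finset.prod_eq_zero (Finset.mem_univ i) hi, zero_mul]
    refine Finset.sum_eq_zero fun y _ => ?_
    rw [Finset.prod_eq_zero (Finset.mem_univ i) (hi' _ (Finset.mem_univ _)), zero_mul]
  · push Not at h0
    simp_rw [Finset.mul_sum]
    rw [Finset.sum_comm]
    refine Finset.sum_congr rfl fun i _ => ?_
    calc _ = ∑ y : Fin n → A, ∏ k, a k (y k) * (if k = i then φ i (y k) else 1) := by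
          refine Finset.sum_congr rfl fun y _ => ?_
          rw [Finset.prod_mul_distrib, Finset.prod_ite_eq' Finset.univ i]
          simp
      _ = ∏ k, ∑ y, a k y * (if k = i then φ i y else 1) := by
          rw [Finset.prod_univ_sum, Fintype.piFinset_univ]
      _ = ∏ k, (∑ y, a k y) *
            (if k = i then (∑ y, a k y * φ k y) / ∑ y, a k y else 1) := by
          refine Finset.prod_congr rfl fun k _ => ?_
          split_ifs with hk
          · subst hk
            have := h0 k
            field_simp
          · simp
      _ = _ := by
          rw [Finset.prod_mul_distrib, Finset.prod_ite_eq' Finset.univ i]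
          simp

/-- A bounded near-optimal test function in the variational formula for mutual information. -/
lemma exists_test_function {Ω α β : Type*} [MeasurableSpace Ω] [Fintype α] [Fintype β]
    (μ : Measure Ω) [IsProbabilityMeasure μ] {A : Ω → α} {B : Ω → β}
    (hA : ∀ a, MeasurableSet (A ⁻¹' {a})) (hB : ∀ b, MeasurableSet (B ⁻¹' {b}))
    {ε : ℝ} (hε : 0 < ε) :
    ∃ φ : α → β → ℝ, (∀ b, ∑ a, μ.real (A ⁻¹' {a}) * exp (φ a b) ≤ 1) ∧
      miFin μ A B - ε ≤
        ∑ z : α × β, μ.real ((fun ω => (A ω, B ω)) ⁻¹' {z}) * φ z.1 z.2 := by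
  set ι : α → β → ℝ := fun a b => μ.real ((fun ω => (A ω, B ω)) ⁻¹' {(a, b)}) /
    (μ.real (A ⁻¹' {a}) * μ.real (B ⁻¹' {b})) with hι
  have hι0 : ∀ a b, 0 ≤ ι a b := fun a b => by positivity
  set κ := exp (-ε) with hκ
  have hκ0 : 0 < κ := exp_pos _
  have hκ1 : κ < 1 := exp_lt_one_iff.2 (neg_lt_zero.2 hε)
  have hpos : ∀ a b, 0 < κ * ι a b + (1 - κ) := fun a b =>
    add_pos_of_nonneg_of_pos (mul_nonneg hκ0.le (hι0 a b)) (by linarith)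
  refine ⟨fun a b => log (κ * ι a b + (1 - κ)), fun b => ?_, ?_⟩
  · simp_rw [exp_log (hpos _ b)]
    have h1 : ∑ a, μ.real (A ⁻¹' {a}) * ι a b ≤ 1 := by
      calc _ ≤ ∑ a, μ.real ((fun ω => (A ω, B ω)) ⁻¹' {(a, b)}) / μ.real (B ⁻¹' {b}) :=
            Finset.sum_le_sum fun s _ => by
              have h0 : 0 ≤ μ.real (A ⁻¹' {s}) := measureReal_nonneg
              rcases h0.eq_or_lt with h | h
              · rw [← h, zero_mul]; positivity
              · simp only [hι]
                rw [mul_div_assoc', mul_div_mul_left _ _ h.ne']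
        _ ≤ 1 := by
            rw [← Finset.sum_div, sum_real_preimage_pair_fst μ hA hB]
            exact div_self_le_one _
    have e : ∑ a, μ.real (A ⁻¹' {a}) * (κ * ι a b + (1 - κ)) =
        κ * ∑ a, μ.real (A ⁻¹' {a}) * ι a b + (1 - κ) * ∑ a, μ.real (A ⁻¹' {a}) := by
      rw [Finset.mul_sum, Finset.mul_sum, ← Finset.sum_add_distrib]
      exact Finset.sum_congr rfl fun a _ => by ring
    rw [e, sum_real_preimage_singleton_eq_one μ hA]
    nlinarith
  · have hAB := measurableSet_pair_preimage hA hB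
    have e : miFin μ A B - ε = ∑ z : α × β, μ.real ((fun ω => (A ω, B ω)) ⁻¹' {z}) *
        (log (ι z.1 z.2) - ε) := by
      simp only [mul_sub, Finset.sum_sub_distrib, ← Finset.sum_mul,
        sum_real_preimage_singleton_eq_one μ hAB, one_mul]
      rw [miFin_eq_sum_log μ hA hB]
    rw [e]
    refine Finset.sum_le_sum fun z _ => ?_
    have hz : 0 ≤ μ.real ((fun ω => (A ω, B ω)) ⁻¹' {z}) := measureReal_nonneg
    rcases hz.eq_or_lt with h0 | h0
    · rw [← h0]; simp
    · refine mul_le_mul_of_nonneg_left ?_ hz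
      have hιz : 0 < ι z.1 z.2 := div_pos h0
        (mul_pos (h0.trans_le (real_pair_le_fst μ A B z)) (h0.trans_le (real_pair_le_snd μ A B z)))
      calc log (ι z.1 z.2) - ε = log (κ * ι z.1 z.2) := by
            rw [log_mul hκ0.ne' hιz.ne', hκ, log_exp]; ring
        _ ≤ _ := log_le_log (by positivity) (by linarith)

/-- Mutual information of a block with a code for a finite-valued observation is at least the
expected score of the codewords. -/
lemma score_le_miFin_pi {Ω α S β : Type*} [MeasurableSpace Ω] [Fintype α] [Fintype S]
    (μ : Measure Ω) [IsProbabilityMeasure μ] {A : Ω → α} {B : Ω → S}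
    (hA : ∀ a, MeasurableSet (A ⁻¹' {a})) (hB : ∀ b, MeasurableSet (B ⁻¹' {b}))
    (φ : α → β → ℝ) (hφ : ∀ b, ∑ a, μ.real (A ⁻¹' {a}) * exp (φ a b) ≤ 1)
    {n m : ℕ} (c : Fin (m + 1) → Fin n → β) (f : (Fin n → S) → Fin (m + 1)) :
    ∑ x : Fin n → S, (∏ i, μ.real (B ⁻¹' {x i})) * ∑ i,
        (∑ a, μ.real ((fun ω => (A ω, B ω)) ⁻¹' {(a, x i)}) * φ a (c (f x) i)) /
          μ.real (B ⁻¹' {x i}) ≤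
      miFin (Measure.pi fun _ : Fin n => μ) (fun ω i => A (ω i))
        (fun ω => f fun i => B (ω i)) := by
  set ν := Measure.pi fun _ : Fin n => μ with hν
  have hf : ∀ j, MeasurableSet ((fun ω : Fin n → Ω => f fun i => B (ω i)) ⁻¹' {j}) := fun j => by
    have : (fun ω : Fin n → Ω => f fun i => B (ω i)) ⁻¹' {j} =
        (fun ω i => B (ω i)) ⁻¹' (f ⁻¹' {j}) := rfl
    rw [this, ← Set.biUnion_preimage_singleton]
    exact MeasurableSet.biUnion (Set.to_countable _) fun a _ =>
      measurableSet_pi_preimage_singleton hB a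
  have hAB := measurableSet_pair_preimage hA hB
  refine le_trans (le_of_eq ?_) (sum_log_le_miFin ν (measurableSet_pi_preimage_singleton hA) hf
    (fun y j => exp (∑ i, φ (y i) (c j i))) (fun _ _ => (exp_pos _).le)
    (fun _ _ => exp_pos _) fun j => ?_)
  · simp only [log_exp]
    have h := sum_real_preimage_comp ν
      (A := fun (ω : Fin n → Ω) i => (A (ω i), B (ω i))) (measurableSet_pi_preimage_singleton hAB)
      (fun w => ((fun i => (w i).1, f fun i => (w i).2) : (Fin n → α) × Fin (m + 1)))
      (fun z => ∑ i, φ (z.1 i) (c z.2 i))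
    refine Eq.trans ?_ h.symm
    rw [← Equiv.sum_comp (Equiv.arrowProdEquivProdArrow (Fin n) (fun _ => α) (fun _ => S)).symm,
      Fintype.sum_prod_type_right]
    refine Finset.sum_congr rfl fun x _ => ?_
    have hs := sum_prod_mul_sum
      (fun i a => μ.real ((fun ω => (A ω, B ω)) ⁻¹' {(a, x i)})) (fun i a => φ a (c (f x) i))
      (fun _ _ => measureReal_nonneg)
    simp only [sum_real_preimage_pair_fst μ hA hB] at hs
    rw [← hs]
    refine Finset.sum_congr rfl fun y _ => ?_
    exact congrArg (· * ∑ i, φ (y i) (c (f x) i))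
      (pi_real_preimage_singleton μ (fun ω => (A ω, B ω)) fun i => (y i, x i)).symm
  · simp only [hν, pi_real_preimage_singleton, exp_sum, ← Finset.prod_mul_distrib]
    have : ∑ y : Fin n → α, ∏ i, μ.real (A ⁻¹' {y i}) * exp (φ (y i) (c j i)) =
        ∏ i, ∑ a, μ.real (A ⁻¹' {a}) * exp (φ a (c j i)) := by
      rw [Finset.prod_univ_sum, Fintype.piFinset_univ]
    rw [this]
    exact Finset.prod_le_one (fun i _ => Finset.sum_nonneg fun a _ => by positivity)
      (fun i _ => hφ _)

/-- Proposition 3 of the paper: for finite `𝒴`, `𝒰`, arbitrary `𝒳` and a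
Markov chain `Y ⊸ X ⊸ U`, for every `ε > 0` there are `n` and a measurable `f : 𝒳ⁿ → M` with
`(1/n) log |M| ≤ I(X;U) + ε` and `(1/n) I(Yⁿ; f(Xⁿ)) ≥ I(Y;U) − ε`. -/
theorem inner_bound_general_X
    {Ω 𝒴 𝒳 𝒰 : Type*} [MeasurableSpace Ω]
    [Fintype 𝒴] [MeasurableSpace 𝒴] [MeasurableSingletonClass 𝒴]
    [MeasurableSpace 𝒳]
    [Fintype 𝒰] [MeasurableSpace 𝒰] [MeasurableSingletonClass 𝒰]
    (μ : Measure Ω) [IsProbabilityMeasure μ]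
    (Y : Ω → 𝒴) (X : Ω → 𝒳) (U : Ω → 𝒰)
    (hY : Measurable Y) (hX : Measurable X) (hU : Measurable U)
    (hMarkov : Markov μ Y X U) (ε : ℝ) (hε : 0 < ε) :
    ∃ n : ℕ, 0 < n ∧ ∃ (m : ℕ) (f : (Fin n → 𝒳) → Fin (m + 1)), Measurable f ∧
      ENNReal.ofReal (Real.log (m + 1)) ≤ (n : ℝ≥0∞) * (miGen μ X U + ENNReal.ofReal ε) ∧
      (n : ℝ≥0∞) * (miGen μ Y U - ENNReal.ofReal ε) ≤
        miGen (Measure.pi fun _ : Fin n => μ)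
          (fun ω i => Y (ω i)) (fun ω => f fun i => X (ω i)) := by
  have hYs : ∀ y, MeasurableSet (Y ⁻¹' {y}) := fun y => hY (measurableSet_singleton y)
  have hUs : ∀ u, MeasurableSet (U ⁻¹' {u}) := fun u => hU (measurableSet_singleton u)
  classical
  have : Nonempty Ω := nonempty_of_isProbabilityMeasure μ
  have : Nonempty 𝒴 := Nonempty.map Y inferInstance
  have : Nonempty 𝒰 := Nonempty.map U inferInstance
  obtain ⟨φ, hφ, hφI⟩ := exists_test_function μ hYs hUs (show 0 < ε / 3 by positivity)
  set L : ℝ := 1 + ∑ z : 𝒴 × 𝒰, |φ z.1 z.2| with hL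
  have hL0 : 0 < L := by positivity
  obtain ⟨N, Q, hQ, hQδ⟩ := exists_quantizer_of_markov μ hY hX hU hMarkov
    (show 0 < ε / 3 / L by positivity)
  have hV : Measurable (Q ∘ X) := hQ.comp hX
  have hVs : ∀ s, MeasurableSet ((Q ∘ X) ⁻¹' {s}) := fun s => hV (measurableSet_singleton s)
  have hI := miFin_nonneg μ hVs hUs
  have hIe := miFin_eq_sum_log μ hVs hUs
  obtain ⟨n, hn, m, c, f, hlog, hscore⟩ := exists_rate_distortion_code
    (fun z => μ.real ((fun ω => ((Q ∘ X) ω, U ω)) ⁻¹' {z})) (fun s => μ.real ((Q ∘ X) ⁻¹' {s}))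
    (fun u => μ.real (U ⁻¹' {u})) (fun _ => measureReal_nonneg)
    (sum_real_preimage_singleton_eq_one μ (measurableSet_pair_preimage hVs hUs))
    (sum_real_preimage_pair_snd μ hVs hUs) (sum_real_preimage_pair_fst μ hVs hUs)
    (hIe ▸ hI)
    (fun z => (∑ y, μ.real ((fun ω => (Y ω, (Q ∘ X) ω)) ⁻¹' {(y, z.1)}) * φ y z.2) /
      μ.real ((Q ∘ X) ⁻¹' {z.1})) (show 0 < ε / 3 by positivity)
  rw [← hIe] at hlog
  have hmi := score_le_miFin_pi μ hYs hVs φ hφ c f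
  have hE : miFin μ Y U - ε / 3 - ε / 3 ≤
      ∑ z, μ.real ((fun ω => ((Q ∘ X) ω, U ω)) ⁻¹' {z}) *
        ((∑ y, μ.real ((fun ω => (Y ω, (Q ∘ X) ω)) ⁻¹' {(y, z.1)}) * φ y z.2) /
          μ.real ((Q ∘ X) ⁻¹' {z.1})) := by
    have p1 : ∀ s u, (fun ω => ((Q ∘ X) ω, U ω)) ⁻¹' {(s, u)} =
        (Q ∘ X) ⁻¹' {s} ∩ U ⁻¹' {u} := fun s u => by ext; simp
    have p2 : ∀ y s, (fun ω => (Y ω, (Q ∘ X) ω)) ⁻¹' {(y, s)} =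
        (Q ∘ X) ⁻¹' {s} ∩ Y ⁻¹' {y} := fun s u => by ext; simp [and_comm]
    have p3 : ∀ z : 𝒴 × 𝒰, (fun ω => (Y ω, U ω)) ⁻¹' {z} =
        Y ⁻¹' {z.1} ∩ U ⁻¹' {z.2} := fun z => by ext; simp [Prod.ext_iff]
    have e : ∑ z, μ.real ((fun ω => ((Q ∘ X) ω, U ω)) ⁻¹' {z}) *
        ((∑ y, μ.real ((fun ω => (Y ω, (Q ∘ X) ω)) ⁻¹' {(y, z.1)}) * φ y z.2) /
          μ.real ((Q ∘ X) ⁻¹' {z.1})) =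
        ∑ z : 𝒴 × 𝒰, (∑ s, μ.real ((Q ∘ X) ⁻¹' {s} ∩ Y ⁻¹' {z.1}) *
          μ.real ((Q ∘ X) ⁻¹' {s} ∩ U ⁻¹' {z.2}) / μ.real ((Q ∘ X) ⁻¹' {s})) * φ z.1 z.2 := by
      simp only [Fintype.sum_prod_type, p1, p2]
      simp only [Finset.sum_mul, Finset.mul_sum, Finset.sum_div]
      rw [Finset.sum_comm, Finset.sum_comm (s := (Finset.univ : Finset 𝒴))]
      refine Finset.sum_congr rfl fun u _ => ?_
      rw [Finset.sum_comm]
      refine Finset.sum_congr rfl fun y _ => Finset.sum_congr rfl fun s _ => ?_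
      ring
    rw [e]
    have hd : ∑ z : 𝒴 × 𝒰, μ.real ((fun ω => (Y ω, U ω)) ⁻¹' {z}) * φ z.1 z.2 -
        ∑ z : 𝒴 × 𝒰, (∑ s, μ.real ((Q ∘ X) ⁻¹' {s} ∩ Y ⁻¹' {z.1}) *
          μ.real ((Q ∘ X) ⁻¹' {s} ∩ U ⁻¹' {z.2}) / μ.real ((Q ∘ X) ⁻¹' {s})) * φ z.1 z.2 ≤
        ε / 3 := by
      rw [← Finset.sum_sub_distrib]
      calc _ ≤ ∑ z : 𝒴 × 𝒰, ε / 3 / L * |φ z.1 z.2| := by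
            refine Finset.sum_le_sum fun z _ => ?_
            rw [p3, ← sub_mul]
            refine (le_abs_self _).trans ?_
            rw [abs_mul, abs_sub_comm]
            exact mul_le_mul_of_nonneg_right (hQδ z.1 z.2) (abs_nonneg _)
        _ = ε / 3 / L * (L - 1) := by rw [← Finset.mul_sum, hL]; ring
        _ ≤ ε / 3 / L * L := mul_le_mul_of_nonneg_left (by linarith) (by positivity)
        _ = ε / 3 := by field_simp
    linarith
  have hlow : n * (miFin μ Y U - ε) ≤ miFin (Measure.pi fun _ : Fin n => μ)
      (fun ω i => Y (ω i)) (fun ω => f fun i => (Q ∘ X) (ω i)) := by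
    refine le_trans ?_ (hscore.trans hmi)
    exact mul_le_mul_of_nonneg_left (by linarith) (Nat.cast_nonneg n)
  have hfm : Measurable (fun x : Fin n → 𝒳 => f fun i => Q (x i)) :=
    (Measurable.of_discrete (f := f)).comp
      (measurable_pi_lambda _ fun i => hQ.comp (measurable_pi_apply i))
  refine ⟨n, hn, m, fun x => f fun i => Q (x i), hfm, ?_, ?_⟩
  · calc ENNReal.ofReal (log (m + 1)) ≤
          ENNReal.ofReal (n * (miFin μ (Q ∘ X) U + ε)) := by
          refine ENNReal.ofReal_le_ofReal (hlog.trans ?_)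
          exact mul_le_mul_of_nonneg_left (by linarith) (Nat.cast_nonneg n)
      _ = n * (ENNReal.ofReal (miFin μ (Q ∘ X) U) + ENNReal.ofReal ε) := by
          rw [ENNReal.ofReal_mul (Nat.cast_nonneg n), ENNReal.ofReal_natCast,
            ENNReal.ofReal_add hI hε.le]
      _ ≤ _ := by
          gcongr
          exact miFin_le_miGen μ hX hU (f := Q) (g := id) hQ measurable_id
  · calc (n : ℝ≥0∞) * (miGen μ Y U - ENNReal.ofReal ε) ≤
          n * (ENNReal.ofReal (miFin μ Y U) - ENNReal.ofReal ε) := by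
          gcongr
          exact miGen_le_miFin μ hYs hUs
      _ = ENNReal.ofReal (n * (miFin μ Y U - ε)) := by
          rw [ENNReal.ofReal_mul (Nat.cast_nonneg n), ENNReal.ofReal_natCast,
            ENNReal.ofReal_sub _ hε.le]
      _ ≤ _ := (ENNReal.ofReal_le_ofReal hlow).trans
          (miFin_le_miGen _ (f := id) (g := id)
            (measurable_pi_lambda _ fun i => hY.comp (measurable_pi_apply i))
            (hfm.comp (measurable_pi_lambda _ fun i => hX.comp (measurable_pi_apply i)))
            measurable_id measurable_id)

end IB
end
end

section
/- Let 𝒴 and 𝒳 be finite sets, 𝒵 an arbitrary measurable space, and μ_{ZYX} a joint law of (Z,Y,X) extending a fixed μ_{YX}. For some n ∈ ℕ, let f : 𝒳^n → M be a function with M a finite set. Then there exists a probability measure μ_{ZYXU}, extending μ_{ZYX}, with 𝒰 finite, such that the Markov chain (Z,Y) ⊸ X ⊸ U holds, I(X;U) ≤ (1/n)·log|M|, and I(Y;U) ≥ (1/n)·I(Y^n; f(X^n)), where (Y^n,X^n) are n i.i.d. copies of (Y,X). -/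
open MeasureTheory Real
open scoped ENNReal

noncomputable section

namespace IB

/-- The contribution `P(U = u) H(A | U = u)` of a single value `u` to the conditional entropy
`H(A | U)`, as a function of the subprobability vector `v a = P(A = a, U = u)`. -/
def condEnt {α : Type*} [Fintype α] (v : α → ℝ) : ℝ :=
  ∑ a, negMulLog (v a) - negMulLog (∑ a, v a)

/-- The log-sum inequality. -/
theorem sum_negMulLog_add_mul_log_le {ι : Type*} [Fintype ι] (a b : ι → ℝ)
    (ha : ∀ i, 0 ≤ a i) (hab : ∀ i, a i ≤ b i) :
    ∑ i, (negMulLog (a i) + a i * log (b i)) ≤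
      negMulLog (∑ i, a i) + (∑ i, a i) * log (∑ i, b i) := by
  set s := ∑ i, a i with hs
  set t := ∑ i, b i with ht
  rcases (Finset.sum_nonneg fun i _ => ha i : 0 ≤ s).eq_or_lt with h0 | hpos
  · have hz : ∀ i, a i = 0 := fun i =>
      (Finset.sum_eq_zero_iff_of_nonneg fun i _ => ha i).1 h0.symm i (Finset.mem_univ i)
    have hs0 : s = 0 := h0.symm
    simp [hz, hs0]
  have htpos : 0 < t := hpos.trans_le (Finset.sum_le_sum fun i _ => hab i)
  have key : ∀ i, negMulLog (a i) + a i * log (b i) ≤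
      a i * (log t - log s) + (s / t * b i - a i) := by
    intro i
    rcases (ha i).eq_or_lt with h | h
    · have : 0 ≤ b i := (ha i).trans (hab i)
      rw [← h]
      simp only [negMulLog_zero, zero_mul, add_zero, sub_zero, zero_add]
      positivity
    · have hb : 0 < b i := h.trans_le (hab i)
      have hlog := log_le_sub_one_of_pos (show 0 < s * b i / (t * a i) by positivity)
      rw [log_div (by positivity) (by positivity), log_mul hpos.ne' hb.ne',
        log_mul htpos.ne' h.ne'] at hlog
      have hmul := mul_le_mul_of_nonneg_left hlog h.le
      have hsimp : a i * (s * b i / (t * a i) - 1) = s / t * b i - a i := by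
        field_simp
      rw [hsimp] at hmul
      simp only [negMulLog]
      linarith
  refine (Finset.sum_le_sum fun i _ => key i).trans_eq ?_
  rw [Finset.sum_add_distrib, Finset.sum_sub_distrib, ← Finset.sum_mul, ← Finset.mul_sum, ← hs,
    ← ht, div_mul_cancel₀ _ htpos.ne', negMulLog]
  ring

theorem condEnt_eq_sum {α : Type*} [Fintype α] (v : α → ℝ) :
    condEnt v = ∑ a, (negMulLog (v a) + v a * log (∑ a, v a)) := by
  rw [condEnt, Finset.sum_add_distrib, ← Finset.sum_mul, negMulLog]
  simp only [negMulLog]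
  ring

theorem sum_condEnt_le {α ι : Type*} [Fintype α] [Fintype ι] (v : ι → α → ℝ)
    (hv : ∀ i a, 0 ≤ v i a) :
    ∑ i, condEnt (v i) ≤ condEnt (fun a => ∑ i, v i a) := by
  simp only [condEnt_eq_sum]
  rw [Finset.sum_comm]
  refine Finset.sum_le_sum fun a _ => ?_
  rw [Finset.sum_comm (f := fun a i => v i a)]
  exact sum_negMulLog_add_mul_log_le _ _ (fun i => hv i a)
    fun i => Finset.single_le_sum (fun b _ => hv i b) (Finset.mem_univ a)

theorem condEnt_const_mul {α : Type*} [Fintype α] (c : ℝ) (v : α → ℝ) :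
    condEnt (fun a => c * v a) = c * condEnt v := by
  simp only [condEnt, ← Finset.mul_sum, negMulLog_mul, Finset.sum_add_distrib, ← Finset.sum_mul]
  ring

theorem condEnt_of_unique {α : Type*} [Fintype α] [Unique α] (v : α → ℝ) : condEnt v = 0 := by
  simp [condEnt]

theorem sum_fin_cons {α : Type*} [Fintype α] {n : ℕ} (g : (Fin (n + 1) → α) → ℝ) :
    ∑ x, g x = ∑ a, ∑ x : Fin n → α, g (Fin.cons a x : Fin (n + 1) → α) := by
  rw [← (Fin.consEquiv fun _ : Fin (n + 1) => α).sum_comp, Fintype.sum_prod_type]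
  rfl

/-- The chain rule for entropy. -/
theorem condEnt_fin_cons {α : Type*} [Fintype α] {n : ℕ} (v : (Fin (n + 1) → α) → ℝ) :
    condEnt v = condEnt (fun a => ∑ x : Fin n → α, v (Fin.cons a x : Fin (n + 1) → α)) +
      ∑ a, condEnt (fun x : Fin n → α => v (Fin.cons a x : Fin (n + 1) → α)) := by
  simp only [condEnt, sum_fin_cons, Finset.sum_sub_distrib]
  ring

theorem sum_prod_apply_eq_prod_sum {α : Type*} [Fintype α] {n : ℕ} (g : Fin n → α → ℝ) :
    ∑ x : Fin n → α, ∏ i, g i (x i) = ∏ i, ∑ a, g i a := by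
  classical
  rw [Finset.prod_univ_sum, Fintype.piFinset_univ]

/-- The entropy of `n` independent copies. -/
theorem sum_negMulLog_prod {α : Type*} [Fintype α] (p : α → ℝ) (hp : ∑ a, p a = 1) (n : ℕ) :
    ∑ x : Fin n → α, negMulLog (∏ i, p (x i)) = n * ∑ a, negMulLog (p a) := by
  induction n with
  | zero => simp
  | succ n ih =>
    have h1 : ∑ x : Fin n → α, ∏ i, p (x i) = 1 := by
      rw [sum_prod_apply_eq_prod_sum fun _ => p, hp, Finset.prod_const_one]
    simp only [sum_fin_cons, Fin.prod_univ_succ, Fin.cons_zero, Fin.cons_succ, negMulLog_mul,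
      Finset.sum_add_distrib, ← Finset.sum_mul, ← Finset.mul_sum, ih, hp, h1]
    push_cast
    ring

theorem sum_negMulLog_le_log_card {α : Type*} [Fintype α] (p : α → ℝ) (h0 : ∀ a, 0 ≤ p a)
    (hp : ∑ a, p a = 1) : ∑ a, negMulLog (p a) ≤ log (Fintype.card α) := by
  have h := sum_negMulLog_add_mul_log_le p (fun _ => 1) h0 fun a =>
    (Finset.single_le_sum (fun b _ => h0 b) (Finset.mem_univ a)).trans_eq hp
  simpa [hp] using h

/-- Single-letterization: a channel `q` on blocks of length `n` can be replaced by a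
channel `q'` on letters, conditional entropies being normalized by the block length. -/
theorem exists_single_letter_channel.{u, v, w} {𝒳 : Type u} {𝒴 : Type v} [Fintype 𝒳] [Fintype 𝒴]
    (p : 𝒴 → 𝒳 → ℝ) (hp : ∀ y x, 0 ≤ p y x) (hp1 : ∑ x, ∑ y, p y x = 1) (n : ℕ) :
    ∀ {M : Type (max u w)} [Fintype M] (q : (Fin n → 𝒳) → M → ℝ),
      (∀ x m, 0 ≤ q x m) → (∀ x, ∑ m, q x m = 1) →
      ∃ (k : ℕ) (q' : 𝒳 → Fin (k + 1) → ℝ),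
        (∀ x u, 0 ≤ q' x u) ∧ (∀ x, ∑ u, q' x u = 1) ∧
        ∑ m, condEnt (fun x => (∏ i, ∑ y, p y (x i)) * q x m) ≤
          n * ∑ u, condEnt (fun x => (∑ y, p y x) * q' x u) ∧
        n * ∑ u, condEnt (fun y => ∑ x, p y x * q' x u) ≤
          ∑ m, condEnt (fun y : Fin n → 𝒴 => ∑ x, (∏ i, p (y i) (x i)) * q x m) := by
  induction n with
  | zero =>
    intro M _ q _ _
    exact ⟨0, fun _ _ => 1, by simp, by simp, by simp [condEnt_of_unique],
      by simp [condEnt_of_unique]⟩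
  | succ n ih =>
    intro M _ q hq hq1
    have hpX : ∀ x, 0 ≤ ∑ y, p y x := fun x => Finset.sum_nonneg fun y _ => hp y x
    have hprod : ∑ x : Fin n → 𝒳, ∏ i, ∑ y, p y (x i) = 1 := by
      rw [sum_prod_apply_eq_prod_sum fun _ x => ∑ y, p y x, hp1, Finset.prod_const_one]
    let q₁ : 𝒳 → M → ℝ := fun a m =>
      ∑ x : Fin n → 𝒳, (∏ i, ∑ y, p y (x i)) * q (Fin.cons a x : Fin (n + 1) → 𝒳) m
    let q₂ : (Fin n → 𝒳) → M × 𝒳 → ℝ := fun x m =>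
      (∑ y, p y m.2) * q (Fin.cons m.2 x : Fin (n + 1) → 𝒳) m.1
    have hq₁ : ∀ a m, 0 ≤ q₁ a m := fun a m => Finset.sum_nonneg fun x _ =>
      mul_nonneg (Finset.prod_nonneg fun i _ => hpX _) (hq _ _)
    have hq₁1 : ∀ a, ∑ m, q₁ a m = 1 := by
      intro a
      simp only [q₁]
      rw [Finset.sum_comm]
      simp only [← Finset.mul_sum, hq1, mul_one, hprod]
    have hq₂ : ∀ x m, 0 ≤ q₂ x m := fun x m => mul_nonneg (hpX _) (hq _ _)
    have hq₂1 : ∀ x, ∑ m, q₂ x m = 1 := by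
      intro x
      simp only [q₂]
      rw [Fintype.sum_prod_type, Finset.sum_comm]
      simp only [← Finset.mul_sum, hq1, mul_one, hp1]
    obtain ⟨k, r, hr, hr1, hrX, hrY⟩ := ih (M := M × 𝒳) q₂ hq₂ hq₂1
    have hX : ∑ m, condEnt (fun x : Fin (n + 1) → 𝒳 => (∏ i, ∑ y, p y (x i)) * q x m) =
        ∑ m, condEnt (fun x => (∑ y, p y x) * q₁ x m) +
          ∑ m, condEnt (fun x : Fin n → 𝒳 => (∏ i, ∑ y, p y (x i)) * q₂ x m) := by
      rw [Fintype.sum_prod_type, ← Finset.sum_add_distrib]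
      refine Finset.sum_congr rfl fun m _ => ?_
      rw [condEnt_fin_cons]
      simp only [Fin.prod_univ_succ, Fin.cons_zero, Fin.cons_succ, q₁, q₂, Finset.mul_sum,
        mul_assoc, mul_left_comm]
    have hY : ∑ m, condEnt (fun y => ∑ x, p y x * q₁ x m) +
          ∑ m, condEnt (fun y : Fin n → 𝒴 => ∑ x, (∏ i, p (y i) (x i)) * q₂ x m) ≤
        ∑ m, condEnt (fun y : Fin (n + 1) → 𝒴 => ∑ x, (∏ i, p (y i) (x i)) * q x m) := by
      rw [Fintype.sum_prod_type, ← Finset.sum_add_distrib]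
      refine Finset.sum_le_sum fun m _ => ?_
      let g : 𝒳 → (Fin n → 𝒴) → ℝ := fun a y =>
        ∑ x : Fin n → 𝒳, (∏ i, p (y i) (x i)) * q (Fin.cons a x : Fin (n + 1) → 𝒳) m
      have hg : ∀ a y, 0 ≤ g a y := fun a y => Finset.sum_nonneg fun x _ =>
        mul_nonneg (Finset.prod_nonneg fun i _ => hp _ _) (hq _ _)
      have hsplit : ∀ (b : 𝒴) (y : Fin n → 𝒴),
          ∑ x, (∏ i, p ((Fin.cons b y : Fin (n + 1) → 𝒴) i) (x i)) * q x m =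
            ∑ a, p b a * g a y := by
        intro b y
        simp only [sum_fin_cons, Fin.prod_univ_succ, Fin.cons_zero, Fin.cons_succ, g,
          Finset.mul_sum, mul_assoc]
      have hmarg : ∀ a, ∑ y, g a y = q₁ a m := by
        intro a
        simp only [g, q₁]
        rw [Finset.sum_comm]
        refine Finset.sum_congr rfl fun x _ => ?_
        rw [← Finset.sum_mul, sum_prod_apply_eq_prod_sum fun i y => p y (x i)]
      rw [condEnt_fin_cons]
      simp only [hsplit]
      refine add_le_add (le_of_eq ?_) ?_
      · congr 1
        funext b
        rw [Finset.sum_comm]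
        simp only [← Finset.mul_sum, hmarg]
      · calc ∑ a, condEnt (fun y : Fin n → 𝒴 => ∑ x, (∏ i, p (y i) (x i)) * q₂ x (m, a))
            = ∑ a, (∑ b, p b a) * condEnt (g a) := by
              refine Finset.sum_congr rfl fun a _ => ?_
              rw [← condEnt_const_mul]
              simp only [g, q₂, Finset.mul_sum, mul_left_comm]
          _ = ∑ b, ∑ a, condEnt (fun y => p b a * g a y) := by
              simp only [condEnt_const_mul]
              rw [Finset.sum_comm]
              simp only [Finset.sum_mul]
          _ ≤ ∑ b, condEnt (fun y => ∑ a, p b a * g a y) :=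
              Finset.sum_le_sum fun b _ =>
                sum_condEnt_le _ fun a y => mul_nonneg (hp _ _) (hg _ _)
    let e : M ⊕ Fin (k + 1) ≃ Fin (Fintype.card M + k + 1) :=
      Fintype.equivFinOfCardEq (by simp [add_assoc])
    let s : 𝒳 → M ⊕ Fin (k + 1) → ℝ := fun x =>
      Sum.elim (fun m => (n + 1 : ℝ)⁻¹ * q₁ x m) fun u => (n + 1 : ℝ)⁻¹ * (n * r x u)
    have hn : 0 < (n + 1 : ℝ)⁻¹ := by positivity
    have hn1 : (n + 1 : ℝ) ≠ 0 := by positivity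
    have hcX : ∀ (c : ℝ) (b : 𝒳 → ℝ), condEnt (fun x => (∑ y, p y x) * (c * b x)) =
        c * condEnt (fun x => (∑ y, p y x) * b x) := by
      intro c b
      rw [← condEnt_const_mul]
      simp only [mul_left_comm]
    have hcY : ∀ (c : ℝ) (b : 𝒳 → ℝ), condEnt (fun y => ∑ x, p y x * (c * b x)) =
        c * condEnt (fun y => ∑ x, p y x * b x) := by
      intro c b
      rw [← condEnt_const_mul]
      simp only [Finset.mul_sum, mul_left_comm]
    refine ⟨Fintype.card M + k, fun x u => s x (e.symm u), ?_, ?_, ?_, ?_⟩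
    · refine fun x u => (?_ : ∀ a, 0 ≤ s x a) (e.symm u)
      rintro (m | u)
      · exact mul_nonneg hn.le (hq₁ x m)
      · exact mul_nonneg hn.le (mul_nonneg n.cast_nonneg (hr x u))
    · intro x
      rw [e.symm.sum_comp (s x), Fintype.sum_sum_type]
      simp only [s, Sum.elim_inl, Sum.elim_inr, ← Finset.mul_sum, hq₁1, hr1]
      field_simp
      ring
    · rw [e.symm.sum_comp (fun u => condEnt fun x => (∑ y, p y x) * s x u),
        Fintype.sum_sum_type, hX]
      simp only [s, Sum.elim_inl, Sum.elim_inr, hcX, ← Finset.mul_sum]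
      push_cast
      rw [← mul_add, mul_inv_cancel_left₀ hn1]
      linarith
    · rw [e.symm.sum_comp (fun u => condEnt fun y => ∑ x, p y x * s x u),
        Fintype.sum_sum_type]
      simp only [s, Sum.elim_inl, Sum.elim_inr, hcY, ← Finset.mul_sum]
      push_cast
      rw [← mul_add, mul_inv_cancel_left₀ hn1]
      linarith

theorem exists_single_letter_channel_of_function.{u, v, w} {𝒳 : Type u} {𝒴 : Type v} {M : Type w}
    [Fintype 𝒳] [Fintype 𝒴] [Fintype M] [DecidableEq M] (p : 𝒴 → 𝒳 → ℝ)
    (hp : ∀ y x, 0 ≤ p y x) (hp1 : ∑ x, ∑ y, p y x = 1) (n : ℕ) (f : (Fin n → 𝒳) → M) :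
    ∃ (k : ℕ) (q : 𝒳 → Fin (k + 1) → ℝ),
      (∀ x u, 0 ≤ q x u) ∧ (∀ x, ∑ u, q x u = 1) ∧
      ∑ m, condEnt (fun x => (∏ i, ∑ y, p y (x i)) * if f x = m then 1 else 0) ≤
        n * ∑ u, condEnt (fun x => (∑ y, p y x) * q x u) ∧
      n * ∑ u, condEnt (fun y => ∑ x, p y x * q x u) ≤
        ∑ m, condEnt (fun y : Fin n → 𝒴 =>
          ∑ x, (∏ i, p (y i) (x i)) * if f x = m then 1 else 0) := by
  obtain ⟨k, q, hq, hq1, hqX, hqY⟩ := exists_single_letter_channel.{u, v, w} p hp hp1 n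
    (M := ULift.{u, w} M) (fun x m => if f x = m.down then 1 else 0)
    (fun _ _ => by split_ifs <;> simp)
    (fun x => (Equiv.ulift.sum_comp fun m => if f x = m then (1 : ℝ) else 0).trans (by simp))
  exact ⟨k, q, hq, hq1, (Equiv.ulift.sum_comp fun m => condEnt fun x : Fin n → 𝒳 =>
      (∏ i, ∑ y, p y (x i)) * if f x = m then 1 else 0).symm.trans_le hqX,
    hqY.trans_eq (Equiv.ulift.sum_comp fun m => condEnt fun y : Fin n → 𝒴 =>
      ∑ x : Fin n → 𝒳, (∏ i, p (y i) (x i)) * if f x = m then 1 else 0)⟩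

theorem miFin_eq_ent_sub {Ω α β : Type*} [MeasurableSpace Ω] [Fintype α] [Fintype β]
    (μ : Measure Ω) [IsFiniteMeasure μ] (A : Ω → α) (B : Ω → β)
    (hA : ∀ a, MeasurableSet (A ⁻¹' {a})) :
    miFin μ A B = ent μ A - ∑ b, condEnt (fun a => μ.real (A ⁻¹' {a} ∩ B ⁻¹' {b})) := by
  have hmarg : ∀ b, ∑ a, μ.real (A ⁻¹' {a} ∩ B ⁻¹' {b}) = μ.real (B ⁻¹' {b}) := by
    intro b
    have h := sum_measureReal_preimage_singleton (μ := μ.restrict (B ⁻¹' {b})) Finset.univ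
      fun a _ => hA a
    simpa [measureReal_restrict_apply, hA] using h
  have hpair : ∀ a b, (fun ω => (A ω, B ω)) ⁻¹' {(a, b)} = A ⁻¹' {a} ∩ B ⁻¹' {b} := by
    intro a b
    ext ω
    simp
  simp only [miFin, ent, condEnt, hmarg, Fintype.sum_prod_type, hpair, Finset.sum_sub_distrib]
  rw [Finset.sum_comm (f := fun a b => negMulLog _)]
  simp only [Measure.real]
  ring

theorem measureReal_inter_preimage_eq_sum {Ω α : Type*} [MeasurableSpace Ω] [Finite α]
    [MeasurableSpace α] [MeasurableSingletonClass α] (μ : Measure Ω) [IsFiniteMeasure μ]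
    {X : Ω → α} (hX : Measurable X) (B : Set Ω) (S : Finset α) :
    μ.real (B ∩ X ⁻¹' S) = ∑ x ∈ S, μ.real (B ∩ X ⁻¹' {x}) := by
  have h := sum_measureReal_preimage_singleton (μ := μ.restrict B) S
    fun x _ => hX (measurableSet_singleton x)
  simp only [measureReal_restrict_apply (hX (measurableSet_singleton _)),
    measureReal_restrict_apply (hX S.measurableSet)] at h
  simpa only [Set.inter_comm] using h.symm

theorem condExp_ind_ae_eq {Ω α : Type*} [MeasurableSpace Ω] [Fintype α]
    [MeasurableSpace α] [MeasurableSingletonClass α] (μ : Measure Ω) [IsFiniteMeasure μ]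
    {X : Ω → α} (hX : Measurable X) {B : Set Ω} (hB : MeasurableSet B) :
    μ[ind B | MeasurableSpace.comap X inferInstance] =ᵐ[μ]
      fun ω => μ.real (B ∩ X ⁻¹' {X ω}) / μ.real (X ⁻¹' {X ω}) := by
  classical
  set c : α → ℝ := fun x => μ.real (B ∩ X ⁻¹' {x}) / μ.real (X ⁻¹' {x}) with hc
  have hcm : Measurable c := measurable_of_finite c
  have hint : Integrable (fun ω => c (X ω)) μ :=
    (Integrable.of_finite (μ := μ.map X) (f := c)).comp_measurable hX
  refine (ae_eq_condExp_of_forall_setIntegral_eq hX.comap_le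
    ((integrable_const (1 : ℝ)).indicator hB) (fun s _ _ => hint.integrableOn) ?_ ?_).symm
  · rintro _ ⟨S, hS, rfl⟩ -
    rw [← setIntegral_map hS hcm.aestronglyMeasurable hX.aemeasurable,
      ← integral_indicator hS, integral_fintype Integrable.of_finite]
    have hind : ∫ ω in X ⁻¹' S, Set.indicator B (fun _ => (1 : ℝ)) ω ∂μ =
        μ.real (B ∩ X ⁻¹' S) := by
      rw [integral_indicator_const _ hB, measureReal_restrict_apply hB, smul_eq_mul, mul_one]
    rw [hind]
    have hsum := measureReal_inter_preimage_eq_sum μ hX B (Finset.univ.filter (· ∈ S))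
    simp only [Finset.coe_filter, Finset.mem_univ, true_and, Set.ofPred_mem_eq] at hsum
    rw [hsum, Finset.sum_filter]
    refine Finset.sum_congr rfl fun x _ => ?_
    rw [map_measureReal_apply hX (measurableSet_singleton x), smul_eq_mul, Set.indicator_apply]
    split_ifs
    · rw [hc]
      rcases eq_or_ne (μ.real (X ⁻¹' {x})) 0 with h0 | h0
      · have : μ.real (B ∩ X ⁻¹' {x}) = 0 :=
          le_antisymm ((measureReal_mono Set.inter_subset_right).trans h0.le) measureReal_nonneg
        simp [h0, this]
      · exact mul_div_cancel₀ _ h0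
    · simp
  · exact (hcm.comp (Measurable.of_comap_le le_rfl)).stronglyMeasurable.aestronglyMeasurable

/-- If `U` is obtained from `X` through a channel `q` without looking at `A`, then
`A ⊸ X ⊸ U`. -/
theorem markov_of_channel {Ω α β γ : Type*} [MeasurableSpace Ω] [MeasurableSpace γ]
    [Fintype α] [MeasurableSpace α] [MeasurableSingletonClass α]
    [Fintype β] [MeasurableSpace β] [MeasurableSingletonClass β]
    (μ : Measure Ω) [IsFiniteMeasure μ] {A : Ω → γ} {X : Ω → α} {U : Ω → β}
    (hA : Measurable A) (hX : Measurable X) (hU : Measurable U) (q : α → β → ℝ)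
    (h : ∀ E, MeasurableSet E → ∀ x u,
      μ.real (A ⁻¹' E ∩ X ⁻¹' {x} ∩ U ⁻¹' {u}) = μ.real (A ⁻¹' E ∩ X ⁻¹' {x}) * q x u) :
    Markov μ A X U := by
  classical
  intro E F hE hF
  have hsum : ∀ E, MeasurableSet E → ∀ x, μ.real (A ⁻¹' E ∩ U ⁻¹' F ∩ X ⁻¹' {x}) =
      μ.real (A ⁻¹' E ∩ X ⁻¹' {x}) * ∑ u with u ∈ F, q x u := by
    intro E hE x
    have := measureReal_inter_preimage_eq_sum μ hU (A ⁻¹' E ∩ X ⁻¹' {x})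
      (Finset.univ.filter (· ∈ F))
    simp only [Finset.coe_filter, Finset.mem_univ, true_and, Set.ofPred_mem_eq, h E hE] at this
    rw [Set.inter_right_comm, this, Finset.mul_sum]
  have huniv := hsum Set.univ MeasurableSet.univ
  simp only [Set.preimage_univ, Set.univ_inter] at huniv
  filter_upwards [condExp_ind_ae_eq μ hX ((hA hE).inter (hU hF)),
    condExp_ind_ae_eq μ hX (hA hE), condExp_ind_ae_eq μ hX (hU hF)] with ω h₁ h₂ h₃
  rw [h₁, h₂, h₃, hsum E hE, huniv]
  rcases eq_or_ne (μ.real (X ⁻¹' {X ω})) 0 with h0 | h0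
  · simp [h0]
  · field_simp

/-- The joint law of a random variable of law `μ` and of the output of the channel `q` whose
input is the image of that random variable under `X`. -/
def channelMeasure {T α β : Type*} [MeasurableSpace T] [Fintype α] [Fintype β]
    [MeasurableSpace β] (μ : Measure T) (X : T → α) (q : α → β → ℝ) : Measure (T × β) :=
  ∑ x, ∑ u, ENNReal.ofReal (q x u) • (μ.restrict (X ⁻¹' {x})).map fun t => (t, u)

theorem channelMeasure_prod {T α β : Type*} [MeasurableSpace T] [Fintype α]
    [MeasurableSpace α] [MeasurableSingletonClass α] [Fintype β] [MeasurableSpace β]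
    [MeasurableSingletonClass β] (μ : Measure T) {X : T → α} (hX : Measurable X)
    (q : α → β → ℝ) {S : Set T} (hS : MeasurableSet S) (F : Set β) :
    channelMeasure μ X q (S ×ˢ F) =
      ∑ x, μ (S ∩ X ⁻¹' {x}) * ∑ u, F.indicator (fun u => ENNReal.ofReal (q x u)) u := by
  classical
  simp only [channelMeasure, Measure.finsetSum_apply, Measure.smul_apply, smul_eq_mul,
    Finset.mul_sum]
  refine Finset.sum_congr rfl fun x _ => Finset.sum_congr rfl fun u _ => ?_
  rw [Measure.map_apply (by fun_prop) (hS.prod F.toFinite.measurableSet),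
    Measure.restrict_apply' (hX (measurableSet_singleton x)), Set.mk_preimage_prod_left_eq_if,
    Set.indicator_apply]
  split_ifs <;> simp [mul_comm]

theorem map_fst_channelMeasure {T α β : Type*} [MeasurableSpace T] [Fintype α]
    [MeasurableSpace α] [MeasurableSingletonClass α] [Fintype β] [MeasurableSpace β]
    [MeasurableSingletonClass β] (μ : Measure T) {X : T → α} (hX : Measurable X)
    {q : α → β → ℝ} (hq : ∀ x u, 0 ≤ q x u) (hq1 : ∀ x, ∑ u, q x u = 1) :
    (channelMeasure μ X q).map Prod.fst = μ := by
  ext S hS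
  have hsum := sum_measure_preimage_singleton (μ := μ.restrict S) Finset.univ
    fun x _ => hX (measurableSet_singleton x)
  rw [Measure.map_apply measurable_fst hS, ← Set.prod_univ, channelMeasure_prod μ hX q hS]
  simp only [Set.indicator_univ, ← ENNReal.ofReal_sum_of_nonneg fun u _ => hq _ u, hq1,
    ENNReal.ofReal_one, mul_one]
  simpa [Measure.restrict_apply (hX (measurableSet_singleton _)), Set.inter_comm] using hsum

theorem channelMeasure_real_prod_singleton {T α β : Type*} [MeasurableSpace T] [Fintype α]
    [MeasurableSpace α] [MeasurableSingletonClass α] [Fintype β] [MeasurableSpace β]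
    [MeasurableSingletonClass β] (μ : Measure T) {X : T → α} (hX : Measurable X)
    {q : α → β → ℝ} (hq : ∀ x u, 0 ≤ q x u) {S : Set T} (hS : MeasurableSet S) (x : α) (u : β) :
    (channelMeasure μ X q).real ((S ∩ X ⁻¹' {x}) ×ˢ {u}) = μ.real (S ∩ X ⁻¹' {x}) * q x u := by
  classical
  have hx := hX (measurableSet_singleton x)
  rw [Measure.real, channelMeasure_prod μ hX q (hS.inter hx), Finset.sum_eq_single x,
    Finset.sum_eq_single u]
  · simp [Set.inter_assoc, Measure.real, hq]
  · intro v _ hv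
    simp [hv]
  · simp
  · intro x' _ hx'
    have : S ∩ X ⁻¹' {x} ∩ X ⁻¹' {x'} = ∅ := by
      ext t
      simp only [Set.mem_inter_iff, Set.mem_preimage, Set.mem_singleton_iff,
        Set.mem_empty_iff_false, iff_false]
      rintro ⟨⟨-, rfl⟩, h⟩
      exact hx' h.symm
    simp [this]
  · simp

theorem measureReal_pi_eq_sum {α : Type*} [Fintype α] [MeasurableSpace α]
    [MeasurableSingletonClass α] (μ : Measure α) [IsProbabilityMeasure μ] (n : ℕ)
    (S : Set (Fin n → α)) :
    (Measure.pi fun _ : Fin n => μ).real S =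
      ∑ ω, S.indicator (fun ω => ∏ i, μ.real {ω i}) ω := by
  classical
  have h := sum_measureReal_singleton (μ := Measure.pi fun _ : Fin n => μ)
    (Finset.univ.filter (· ∈ S))
  simp only [Finset.coe_filter, Finset.mem_univ, true_and, Set.ofPred_mem_eq] at h
  rw [← h, Finset.sum_filter]
  simp [Set.indicator_apply, Measure.real, Measure.pi_singleton, ENNReal.toReal_prod]

/-- The joint law of `Y^n` and a function of `X^n`. -/
theorem measureReal_pi_prod {𝒴 𝒳 M : Type*} [Fintype 𝒴] [MeasurableSpace 𝒴]
    [MeasurableSingletonClass 𝒴] [Fintype 𝒳] [MeasurableSpace 𝒳] [MeasurableSingletonClass 𝒳]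
    [DecidableEq M] (μ : Measure (𝒴 × 𝒳)) [IsProbabilityMeasure μ] (n : ℕ)
    (f : (Fin n → 𝒳) → M) (y : Fin n → 𝒴) (m : M) :
    (Measure.pi fun _ : Fin n => μ).real
        ((fun ω i => (ω i).1) ⁻¹' {y} ∩ (fun ω => f fun i => (ω i).2) ⁻¹' {m}) =
      ∑ x : Fin n → 𝒳, (∏ i, μ.real {(y i, x i)}) * if f x = m then 1 else 0 := by
  classical
  rw [measureReal_pi_eq_sum,
    ← (Equiv.arrowProdEquivProdArrow (Fin n) (fun _ => 𝒴) (fun _ => 𝒳)).symm.sum_comp,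
    Fintype.sum_prod_type, Finset.sum_eq_single y]
  · simp [Set.indicator_apply, Equiv.arrowProdEquivProdArrow]
  · intro y' _ hy
    have : (fun i => y' i) ≠ y := hy
    simp [Equiv.arrowProdEquivProdArrow, this]
  · simp

/-- Corollary 9 of the paper: as in the discrete converse, but with an extra
random variable `Z` on an arbitrary alphabet; the constructed `U` satisfies the Markov chain
`(Z,Y) ⊸ X ⊸ U`. -/
theorem discrete_outer_bound_with_Z
    {𝒵 𝒴 𝒳 : Type*} [MeasurableSpace 𝒵]
    [Fintype 𝒴] [MeasurableSpace 𝒴] [MeasurableSingletonClass 𝒴]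
    [Fintype 𝒳] [MeasurableSpace 𝒳] [MeasurableSingletonClass 𝒳]
    (μYX : Measure (𝒴 × 𝒳)) [IsProbabilityMeasure μYX]
    (μZYX : Measure (𝒵 × 𝒴 × 𝒳)) [IsProbabilityMeasure μZYX]
    (hext : Measure.map (fun p => p.2) μZYX = μYX)
    (n : ℕ) (hn : 0 < n) {M : Type*} [Fintype M] (f : (Fin n → 𝒳) → M) :
    ∃ (k : ℕ) (μ' : Measure (𝒵 × 𝒴 × 𝒳 × Fin (k + 1))),
      IsProbabilityMeasure μ' ∧
      Measure.map (fun p => (p.1, p.2.1, p.2.2.1)) μ' = μZYX ∧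
      Markov μ' (fun p => (p.1, p.2.1)) (fun p => p.2.2.1) (fun p => p.2.2.2) ∧
      miFin μ' (fun p => p.2.2.1) (fun p => p.2.2.2) ≤ Real.log (Fintype.card M) / n ∧
      miFin (Measure.pi fun _ : Fin n => μYX)
          (fun ω i => (ω i).1) (fun ω => f fun i => (ω i).2) / n ≤
        miFin μ' (fun p => p.2.1) (fun p => p.2.2.2) := by
  classical
  let p : 𝒴 → 𝒳 → ℝ := fun y x => μYX.real {(y, x)}
  have hp : ∀ y x, 0 ≤ p y x := fun _ _ => measureReal_nonneg
  have hpY : ∀ y, ∑ x, p y x = μYX.real (Prod.fst ⁻¹' {y}) := by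
    intro y
    have h := measureReal_inter_preimage_eq_sum μYX measurable_snd (Prod.fst ⁻¹' {y})
      (Finset.univ : Finset 𝒳)
    rw [Finset.coe_univ, Set.preimage_univ, Set.inter_univ] at h
    rw [h]
    refine Finset.sum_congr rfl fun x _ => congrArg μYX.real ?_
    ext ⟨_, _⟩
    simp
  have hpX : ∀ x, ∑ y, p y x = μYX.real (Prod.snd ⁻¹' {x}) := by
    intro x
    have h := measureReal_inter_preimage_eq_sum μYX measurable_fst (Prod.snd ⁻¹' {x})
      (Finset.univ : Finset 𝒴)
    rw [Finset.coe_univ, Set.preimage_univ, Set.inter_univ] at h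
    rw [h]
    refine Finset.sum_congr rfl fun y _ => congrArg μYX.real ?_
    ext ⟨_, _⟩
    simp [and_comm]
  have hp1 : ∑ x, ∑ y, p y x = 1 := by
    have h := measureReal_inter_preimage_eq_sum μYX measurable_snd Set.univ
      (Finset.univ : Finset 𝒳)
    simp only [Finset.coe_univ, Set.preimage_univ, Set.inter_univ, Set.univ_inter,
      probReal_univ] at h
    simp only [hpX, h]
  have hp1' : ∑ y, ∑ x, p y x = 1 := by rw [Finset.sum_comm, hp1]
  obtain ⟨k, q, hq, hq1, hqX, hqY⟩ := exists_single_letter_channel_of_function p hp hp1 n f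
  have hX : Measurable fun t : 𝒵 × 𝒴 × 𝒳 => t.2.2 := by fun_prop
  have hassoc : Measurable fun t : (𝒵 × 𝒴 × 𝒳) × Fin (k + 1) =>
      (t.1.1, t.1.2.1, t.1.2.2, t.2) := by fun_prop
  set μ' := (channelMeasure μZYX (fun t => t.2.2) q).map
    fun t => (t.1.1, t.1.2.1, t.1.2.2, t.2) with hμ'
  have hmap : Measure.map (fun p => (p.1, p.2.1, p.2.2.1)) μ' = μZYX := by
    rw [hμ', Measure.map_map (by fun_prop) hassoc]
    exact map_fst_channelMeasure μZYX hX hq hq1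
  have hprob : IsProbabilityMeasure μ' := by
    have : IsProbabilityMeasure (Measure.map (fun p => (p.1, p.2.1, p.2.2.1)) μ') := by
      rw [hmap]; infer_instance
    exact Measure.isProbabilityMeasure_of_map
      fun p : 𝒵 × 𝒴 × 𝒳 × Fin (k + 1) => (p.1, p.2.1, p.2.2.1)
  have hlaw : ∀ S : Set (𝒵 × 𝒴 × 𝒳), MeasurableSet S →
      μ'.real ((fun p => (p.1, p.2.1, p.2.2.1)) ⁻¹' S) = μZYX.real S := by
    intro S hS
    rw [← hmap, map_measureReal_apply (by fun_prop) hS]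
  have hchan : ∀ E : Set (𝒵 × 𝒴), MeasurableSet E → ∀ x u,
      μ'.real ((fun p => (p.1, p.2.1)) ⁻¹' E ∩ (fun p => p.2.2.1) ⁻¹' {x} ∩
        (fun p => p.2.2.2) ⁻¹' {u}) =
      μ'.real ((fun p => (p.1, p.2.1)) ⁻¹' E ∩ (fun p => p.2.2.1) ⁻¹' {x}) * q x u := by
    intro E hE x u
    have hS : MeasurableSet ((fun t : 𝒵 × 𝒴 × 𝒳 => (t.1, t.2.1)) ⁻¹' E) :=
      (by fun_prop : Measurable fun t : 𝒵 × 𝒴 × 𝒳 => (t.1, t.2.1)) hE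
    have hx := hX (measurableSet_singleton x)
    refine Eq.trans ?_ ((channelMeasure_real_prod_singleton μZYX hX hq hS x u).trans ?_)
    · rw [hμ', map_measureReal_apply hassoc]
      · rfl
      · exact (((by fun_prop : Measurable fun p : 𝒵 × 𝒴 × 𝒳 × Fin (k + 1) => (p.1, p.2.1))
          hE).inter ((by fun_prop : Measurable fun p : 𝒵 × 𝒴 × 𝒳 × Fin (k + 1) => p.2.2.1)
          (measurableSet_singleton x))).inter
          ((by fun_prop : Measurable fun p : 𝒵 × 𝒴 × 𝒳 × Fin (k + 1) => p.2.2.2)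
          (measurableSet_singleton u))
    · rw [← hlaw _ (hS.inter hx)]
      rfl
  have hYX : ∀ S : Set (𝒴 × 𝒳), μ'.real ((fun p => (p.2.1, p.2.2.1)) ⁻¹' S) = μYX.real S := by
    intro S
    rw [← hext, map_measureReal_apply measurable_snd S.toFinite.measurableSet,
      ← hlaw _ (measurable_snd S.toFinite.measurableSet)]
    rfl
  have hXU : ∀ x u, μ'.real ((fun p => p.2.2.1) ⁻¹' {x} ∩ (fun p => p.2.2.2) ⁻¹' {u}) =
      (∑ y, p y x) * q x u := by
    intro x u
    have h := hchan Set.univ MeasurableSet.univ x u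
    rw [Set.preimage_univ, Set.univ_inter] at h
    rw [h, hpX, ← hYX]
    rfl
  have hYU : ∀ y u, μ'.real ((fun p => p.2.1) ⁻¹' {y} ∩ (fun p => p.2.2.2) ⁻¹' {u}) =
      ∑ x, p y x * q x u := by
    intro y u
    have h := measureReal_inter_preimage_eq_sum μ'
      (by fun_prop : Measurable fun p : 𝒵 × 𝒴 × 𝒳 × Fin (k + 1) => p.2.2.1)
      ((fun p => p.2.1) ⁻¹' {y} ∩ (fun p => p.2.2.2) ⁻¹' {u}) Finset.univ
    rw [Finset.coe_univ, Set.preimage_univ, Set.inter_univ] at h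
    rw [h]
    refine Finset.sum_congr rfl fun x _ => ?_
    rw [Set.inter_right_comm]
    refine (hchan (Prod.snd ⁻¹' {y}) (measurable_snd (measurableSet_singleton y)) x u).trans ?_
    congr 1
    simp only [p]
    rw [← hYX]
    congr 1
    ext
    simp
  have hentX : ent μ' (fun p => p.2.2.1) = ∑ x, negMulLog (∑ y, p y x) := by
    simp only [ent, hpX, ← hYX]
    rfl
  have hentY : ent μ' (fun p => p.2.1) = ∑ y, negMulLog (∑ x, p y x) := by
    simp only [ent, hpY, ← hYX]
    rfl
  have hn' : (0 : ℝ) < n := Nat.cast_pos.2 hn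
  refine ⟨k, μ', hprob, hmap, markov_of_channel μ' (by fun_prop) (by fun_prop) (by fun_prop) q
    hchan, ?_, ?_⟩
  · rw [miFin_eq_ent_sub μ' _ _ fun x =>
      (by fun_prop : Measurable fun p : 𝒵 × 𝒴 × 𝒳 × Fin (k + 1) => p.2.2.1)
        (measurableSet_singleton x), hentX, le_div_iff₀ hn']
    simp only [hXU]
    have hblock : n * ∑ x, negMulLog (∑ y, p y x) - log (Fintype.card M) ≤
        ∑ m, condEnt (fun x : Fin n → 𝒳 => (∏ i, ∑ y, p y (x i)) * if f x = m then 1 else 0) := by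
      have hW := sum_negMulLog_le_log_card
        (fun m => ∑ x : Fin n → 𝒳, (∏ i, ∑ y, p y (x i)) * if f x = m then 1 else 0)
        (fun m => Finset.sum_nonneg fun x _ => mul_nonneg
          (Finset.prod_nonneg fun i _ => Finset.sum_nonneg fun y _ => hp _ _)
          (by split_ifs <;> simp))
        (by
          rw [Finset.sum_comm]
          simp only [← Finset.mul_sum, Finset.sum_ite_eq, Finset.mem_univ, if_true, mul_one]
          rw [sum_prod_apply_eq_prod_sum fun _ x => ∑ y, p y x, hp1, Finset.prod_const_one])
      have hXW : ∑ m, ∑ x : Fin n → 𝒳,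
          negMulLog ((∏ i, ∑ y, p y (x i)) * if f x = m then 1 else 0) =
          n * ∑ x, negMulLog (∑ y, p y x) := by
        rw [Finset.sum_comm, ← sum_negMulLog_prod (fun x => ∑ y, p y x) hp1]
        refine Finset.sum_congr rfl fun x _ => ?_
        rw [Finset.sum_eq_single (f x)] <;> simp +contextual [eq_comm]
      simp only [condEnt, Finset.sum_sub_distrib, hXW]
      linarith
    linarith
  · have hentYn : ent (Measure.pi fun _ : Fin n => μYX) (fun ω i => (ω i).1) =
        n * ∑ y, negMulLog (∑ x, p y x) := by
      rw [← sum_negMulLog_prod (fun y => ∑ x, p y x) hp1']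
      refine Finset.sum_congr rfl fun y _ => congrArg negMulLog ?_
      have h := measureReal_pi_prod μYX n (fun _ => ()) y ()
      rw [Set.preimage_const_of_mem (Set.mem_singleton _), Set.inter_univ] at h
      refine h.trans ?_
      simp only [if_true, mul_one]
      exact sum_prod_apply_eq_prod_sum fun i x => p (y i) x
    rw [miFin_eq_ent_sub μ' _ _ fun y =>
      (by fun_prop : Measurable fun p : 𝒵 × 𝒴 × 𝒳 × Fin (k + 1) => p.2.1)
        (measurableSet_singleton y), hentY, div_le_iff₀ hn',
      miFin_eq_ent_sub _ _ _ fun y => Set.Finite.measurableSet (Set.toFinite _), hentYn]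
    simp only [hYU, measureReal_pi_prod]
    linarith

end IB
end
end
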